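/- arXiv:1305.1098 — 2 statements merged into one kernel-verified Lean document; each statement's English description precedes it below -/
import Mathlib

section
/- Let d ≥ 3 and m ≥ 0 be integers, set n = d + m(d−2), and let M_T = (m_{i,j}) be the n×n matrix of d-path numbers associated to a d-angulation T of the convex n-gon. Then det M_T = (−1)^{n−1} (d−1)^{m+1}. In particular the determinant is independent of the particular d-angulation T. -/
noncomputable section

/-- The `k`-th vertex of a regular `n`-gon inscribed in the unit circle. -/
def vtx (n : ℕ) (k : ZMod n) : ℝ × ℝ :=
  (Real.cos (2 * Real.pi * k.val / n), Real.sin (2 * Real.pi * k.val / n))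

/-- The convex hull spanned by a set `c` of vertices of the `n`-gon. -/
def cellHull (n : ℕ) (c : Finset (ZMod n)) : Set (ℝ × ℝ) :=
  convexHull ℝ (vtx n '' (c : Set (ZMod n)))

/-- `T` is a `d`-angulation of the convex `n`-gon: a dissection of the polygon by
pairwise non-crossing diagonals into `d`-gon cells.  Each cell is recorded by its
vertex set; the cells cover the polygon and have pairwise disjoint interiors. -/
def IsDAngulation (n d : ℕ) (T : Finset (Finset (ZMod n))) : Prop :=
  (∀ c ∈ T, c.card = d) ∧
  (⋃ c ∈ T, cellHull n c) = convexHull ℝ (Set.range (vtx n)) ∧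
  ∀ c ∈ T, ∀ c' ∈ T, c ≠ c' →
    interior (cellHull n c) ∩ interior (cellHull n c') = ∅

/-- The number of vertices strictly between `i` and `j`, going counterclockwise. -/
def pathLen (n : ℕ) (i j : ZMod n) : ℕ := (j - i - 1).val

/-- A (counterclockwise) `d`-path from `i` to `j` in the `d`-angulation `T`:
a sequence `p_{i+1}, …, p_{j-1}` of cells of `T`, indexed by the vertices
encountered going counterclockwise from `i` to `j`, such that the cell at
position `k` is incident to the vertex `i+1+k`, and each cell of `T` occurs
at most `d - 2` times in the sequence. -/
def IsDPath (n d : ℕ) (T : Finset (Finset (ZMod n))) (i j : ZMod n)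
    (q : Fin (pathLen n i j) → {c // c ∈ T}) : Prop :=
  (∀ k, (i + 1 + ((k : ℕ) : ZMod n)) ∈ (q k : Finset (ZMod n))) ∧
  ∀ c ∈ T, (Finset.univ.filter (fun k => (q k : Finset (ZMod n)) = c)).card ≤ d - 2

/-- The number `m_{i,j}` of counterclockwise `d`-paths from `i` to `j`. -/
def dPathCount (n d : ℕ) (T : Finset (Finset (ZMod n))) (i j : ZMod n) : ℕ :=
  Nat.card {q : Fin (pathLen n i j) → {c // c ∈ T} // IsDPath n d T i j q}

/-- Twice the signed area of the triangle `p q r`. -/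
def area (p q r : ℝ × ℝ) : ℝ :=
  (q.1 - p.1) * (r.2 - p.2) - (q.2 - p.2) * (r.1 - p.1)

lemma area_swap (p q r : ℝ × ℝ) : area q p r = -area p q r := by
  unfold area; ring

lemma area_rotate (p q r : ℝ × ℝ) : area q r p = area p q r := by
  unfold area; ring

lemma continuous_area (p q : ℝ × ℝ) : Continuous (area p q) := by
  unfold area; fun_prop

lemma area_combo (p q x y : ℝ × ℝ) {s t : ℝ} (h : s + t = 1) :
    area p q (s • x + t • y) = s * area p q x + t * area p q y := by
  obtain rfl : s = 1 - t := by linarith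
  simp only [area, Prod.fst_add, Prod.snd_add, Prod.smul_fst, Prod.smul_snd, smul_eq_mul]
  ring

lemma area_sum {ι : Type*} (s : Finset ι) (w : ι → ℝ) (z : ι → ℝ × ℝ) (hw : ∑ i ∈ s, w i = 1)
    (p q : ℝ × ℝ) : area p q (∑ i ∈ s, w i • z i) = ∑ i ∈ s, w i * area p q (z i) := by
  have h : ∀ i ∈ s, w i * area p q (z i) =
      (q.1 - p.1) * (w i * (z i).2) - (q.2 - p.2) * (w i * (z i).1)
        - w i * ((q.1 - p.1) * p.2 - (q.2 - p.2) * p.1) := by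
    intro i _; unfold area; ring
  rw [Finset.sum_congr rfl h, Finset.sum_sub_distrib, Finset.sum_sub_distrib, ← Finset.mul_sum,
    ← Finset.mul_sum, ← Finset.sum_mul, hw]
  simp only [area, Prod.fst_sum, Prod.snd_sum, Prod.smul_fst, Prod.smul_snd, smul_eq_mul]
  ring

lemma area_circle (A B C : ℝ) :
    area (Real.cos A, Real.sin A) (Real.cos B, Real.sin B) (Real.cos C, Real.sin C) =
      4 * Real.sin ((B - A) / 2) * Real.sin ((C - A) / 2) * Real.sin ((C - B) / 2) := by
  have h : (C - B) / 2 = (C + A) / 2 - (B + A) / 2 := by ring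
  simp only [area]
  rw [Real.cos_sub_cos, Real.sin_sub_sin, Real.sin_sub_sin, Real.cos_sub_cos, h, Real.sin_sub]
  ring

/-- The open triangle lies in the interior of any convex set containing its vertices. -/
lemma mem_interior_of_area_pos {s : Set (ℝ × ℝ)} (hs : Convex ℝ s) {p q r z : ℝ × ℝ}
    (hp : p ∈ s) (hq : q ∈ s) (hr : r ∈ s) (h₁ : 0 < area p q z) (h₂ : 0 < area q r z)
    (h₃ : 0 < area r p z) : z ∈ interior s := by
  rw [mem_interior]
  refine ⟨{x | 0 < area p q x} ∩ {x | 0 < area q r x} ∩ {x | 0 < area r p x}, ?_, ?_,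
    ⟨⟨h₁, h₂⟩, h₃⟩⟩
  · rintro x ⟨⟨h₁, h₂⟩, h₃⟩
    rw [Set.mem_ofPred_eq] at h₁ h₂ h₃
    have hsum : area p q x + area q r x + area r p x = area p q r := by unfold area; ring
    have hpos : 0 < area p q r := by linarith
    have hx : x = (area q r x / area p q r) • p + (area r p x / area p q r) • q +
        (area p q x / area p q r) • r := by
      have h0 := hpos.ne'
      ext
      · simp only [Prod.fst_add, Prod.smul_fst, smul_eq_mul]
        field_simp
        unfold area; ring
      · simp only [Prod.snd_add, Prod.smul_snd, smul_eq_mul]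
        field_simp
        unfold area; ring
    rw [hx]
    have := hs.sum_mem (t := Finset.univ)
      (w := ![area q r x / area p q r, area r p x / area p q r, area p q x / area p q r])
      (z := ![p, q, r]) ?_ ?_ ?_
    · simpa [Fin.sum_univ_three] using this
    · intro i _
      fin_cases i <;> simp <;> positivity
    · simp only [Fin.sum_univ_three, Matrix.cons_val_zero, Matrix.cons_val_one, Matrix.cons_val]
      field_simp
      linarith
    · intro i _
      fin_cases i <;> simpa
  · exact (((isOpen_lt continuous_const (continuous_area p q)).inter
      (isOpen_lt continuous_const (continuous_area q r))).inter
      (isOpen_lt continuous_const (continuous_area r p)))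

lemma interior_nonempty_of_area_pos {s : Set (ℝ × ℝ)} (hs : Convex ℝ s) {p q r : ℝ × ℝ}
    (hp : p ∈ s) (hq : q ∈ s) (hr : r ∈ s) (h : 0 < area p q r) : (interior s).Nonempty := by
  refine ⟨(1 / 3 : ℝ) • p + (1 / 3 : ℝ) • q + (1 / 3 : ℝ) • r,
    mem_interior_of_area_pos hs hp hq hr ?_ ?_ ?_⟩ <;>
  · refine lt_of_lt_of_eq (div_pos h three_pos) ?_
    simp only [area, Prod.fst_add, Prod.snd_add, Prod.smul_fst, Prod.smul_snd, smul_eq_mul]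
    ring

lemma interior_nonempty_of_area_ne {s : Set (ℝ × ℝ)} (hs : Convex ℝ s) {p q r : ℝ × ℝ}
    (hp : p ∈ s) (hq : q ∈ s) (hr : r ∈ s) (h : area p q r ≠ 0) : (interior s).Nonempty := by
  rcases h.lt_or_gt with h | h
  · exact interior_nonempty_of_area_pos hs hq hp hr (by rw [area_swap]; linarith)
  · exact interior_nonempty_of_area_pos hs hp hq hr h

/-- If the segments `U V` and `X Y` cross and `W`, `Y` are on the positive side of `U V`, then
the segment `X Y` enters the interior of any convex set containing `U`, `V`, `W`. -/
lemma exists_mem_interior_of_cross {s t : Set (ℝ × ℝ)} (hs : Convex ℝ s) (ht : Convex ℝ t)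
    {U V W X Y : ℝ × ℝ} (hU : U ∈ s) (hV : V ∈ s) (hW : W ∈ s) (hX : X ∈ t) (hY : Y ∈ t)
    (hw : 0 < area U V W) (hx : area U V X < 0) (hy : 0 < area U V Y)
    (hu : 0 < area X Y U) (hv : area X Y V < 0) : ∃ z ∈ t, z ∈ interior s := by
  set k := area U V Y - area U V X with hk
  have hkpos : 0 < k := by linarith
  have hk' : k = area X Y U - area X Y V := by rw [hk]; unfold area; ring
  set p : ℝ × ℝ := (area U V Y / k) • X + (-area U V X / k) • Y with hp
  have hp' : p = (-area X Y V / k) • U + (area X Y U / k) • V := by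
    ext
    · simp only [hp, Prod.fst_add, Prod.smul_fst, smul_eq_mul]
      field_simp
      unfold area; ring
    · simp only [hp, Prod.snd_add, Prod.smul_snd, smul_eq_mul]
      field_simp
      unfold area; ring
  have hpt : p ∈ t := by
    refine ht hX hY (by positivity) (div_nonneg (by linarith) hkpos.le) ?_
    field_simp; linarith
  have hsum : -area X Y V / k + area X Y U / k = 1 := by field_simp; linarith
  have hVVW : area V W V = 0 := by unfold area; ring
  have hWUU : area W U U = 0 := by unfold area; ring
  have hUVp : area U V p = 0 := by
    rw [hp, area_combo U V X Y (by field_simp; linarith)]; field_simp; ring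
  have h₂ : 0 < area V W p := by
    rw [hp', area_combo V W U V hsum, hVVW, area_rotate U V W]
    have : 0 < -area X Y V / k := div_pos (by linarith) hkpos
    nlinarith [mul_pos this hw]
  have h₃ : 0 < area W U p := by
    rw [hp', area_combo W U U V hsum, hWUU, area_rotate V W U, area_rotate U V W]
    nlinarith [mul_pos (div_pos hu hkpos) hw]
  have hc : Continuous fun e : ℝ => (1 - e) • p + e • Y := by fun_prop
  have hz : (1 - (0 : ℝ)) • p + (0 : ℝ) • Y = p := by simp
  have e₂ : ∀ᶠ e in nhdsWithin (0 : ℝ) (Set.Ioi 0), 0 < area V W ((1 - e) • p + e • Y) := by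
    refine Filter.Eventually.filter_mono nhdsWithin_le_nhds ?_
    exact ((continuous_area V W).comp hc).continuousAt.eventually
      (lt_mem_nhds (by simpa only [Function.comp, hz] using h₂))
  have e₃ : ∀ᶠ e in nhdsWithin (0 : ℝ) (Set.Ioi 0), 0 < area W U ((1 - e) • p + e • Y) := by
    refine Filter.Eventually.filter_mono nhdsWithin_le_nhds ?_
    exact ((continuous_area W U).comp hc).continuousAt.eventually
      (lt_mem_nhds (by simpa only [Function.comp, hz] using h₃))
  have e₄ : ∀ᶠ e in nhdsWithin (0 : ℝ) (Set.Ioi 0), e ∈ Set.Ioo (0 : ℝ) 1 :=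
    Ioo_mem_nhdsGT one_pos
  obtain ⟨e, h₂, h₃, he0, he1⟩ := (e₂.and (e₃.and e₄)).exists
  refine ⟨_, ht hpt hY (by linarith) he0.le (by ring),
    mem_interior_of_area_pos hs hU hV hW ?_ h₂ h₃⟩
  rw [area_combo _ _ _ _ (by ring), hUVp]
  nlinarith

lemma inter_interior_nonempty {s t : Set (ℝ × ℝ)} (ht : Convex ℝ t) (hne : (interior t).Nonempty)
    {z : ℝ × ℝ} (hz : z ∈ t) (hzs : z ∈ interior s) : (interior s ∩ interior t).Nonempty := by
  have h : z ∈ closure (interior t) := by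
    rw [ht.closure_interior_eq_closure_of_nonempty_interior hne]
    exact subset_closure hz
  exact mem_closure_iff.1 h _ isOpen_interior hzs

section Vertices

variable {n : ℕ}

lemma area_vtx_pos [NeZero n] {a b c : ZMod n} (hab : a.val < b.val) (hbc : b.val < c.val) :
    0 < area (vtx n a) (vtx n b) (vtx n c) := by
  have hn : (0 : ℝ) < n := by exact_mod_cast NeZero.pos n
  have key : ∀ x y : ZMod n, x.val < y.val →
      0 < Real.sin ((2 * Real.pi * y.val / n - 2 * Real.pi * x.val / n) / 2) := by
    intro x y hxy
    have h1 : (x.val : ℝ) < y.val := by exact_mod_cast hxy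
    have h2 : (y.val : ℝ) < n := by exact_mod_cast ZMod.val_lt y
    have h3 : (0 : ℝ) ≤ x.val := by positivity
    have e : (2 * Real.pi * y.val / n - 2 * Real.pi * x.val / n) / 2 =
        Real.pi * ((y.val - x.val) / n) := by field_simp
    rw [e]
    apply Real.sin_pos_of_pos_of_lt_pi
    · have : 0 < ((y.val : ℝ) - x.val) / n := div_pos (by linarith) hn
      positivity
    · have : ((y.val : ℝ) - x.val) / n < 1 := by rw [div_lt_one hn]; linarith
      nlinarith [Real.pi_pos]
  rw [vtx, vtx, vtx, area_circle]
  have := key a b hab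
  have := key b c hbc
  have := key a c (hab.trans hbc)
  positivity

lemma area_vtx_between [NeZero n] {u v x : ZMod n} (h₁ : u.val < x.val) (h₂ : x.val < v.val) :
    area (vtx n u) (vtx n v) (vtx n x) < 0 := by
  have := area_vtx_pos h₁ h₂
  rw [area_rotate, area_swap]
  linarith

lemma area_vtx_outside [NeZero n] {u v x : ZMod n} (huv : u.val < v.val)
    (h : x.val < u.val ∨ v.val < x.val) : 0 < area (vtx n u) (vtx n v) (vtx n x) := by
  rcases h with h | h
  · rw [area_rotate]
    exact area_vtx_pos h huv
  · exact area_vtx_pos huv h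

lemma area_vtx_ne_zero [NeZero n] {u v x : ZMod n} (huv : u.val < v.val) (hu : x ≠ u) (hv : x ≠ v) :
    area (vtx n u) (vtx n v) (vtx n x) ≠ 0 := by
  have hu' : x.val ≠ u.val := fun h => hu (ZMod.val_injective n h)
  have hv' : x.val ≠ v.val := fun h => hv (ZMod.val_injective n h)
  by_cases h : u.val < x.val ∧ x.val < v.val
  · exact (area_vtx_between h.1 h.2).ne
  · exact (area_vtx_outside huv (by omega)).ne'

lemma vtx_mem_cellHull {c : Finset (ZMod n)} {x : ZMod n} (hx : x ∈ c) : vtx n x ∈ cellHull n c :=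
  subset_convexHull ℝ _ ⟨x, hx, rfl⟩

lemma exists_third {c : Finset (ZMod n)} (hc : 3 ≤ c.card) (u v : ZMod n) :
    ∃ w ∈ c, w ≠ u ∧ w ≠ v := by
  have h : ({u, v} : Finset (ZMod n)).card < c.card :=
    lt_of_le_of_lt Finset.card_le_two (by omega)
  obtain ⟨w, hw, hw'⟩ := Finset.exists_mem_notMem_of_card_lt_card h
  simp only [Finset.mem_insert, Finset.mem_singleton, not_or] at hw'
  exact ⟨w, hw, hw'⟩

lemma interior_cellHull_nonempty [NeZero n] {c : Finset (ZMod n)} (hc : 3 ≤ c.card) {u v : ZMod n}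
    (hu : u ∈ c) (hv : v ∈ c) (huv : u.val < v.val) : (interior (cellHull n c)).Nonempty := by
  obtain ⟨w, hw, hwu, hwv⟩ := exists_third hc u v
  exact interior_nonempty_of_area_ne (convex_convexHull ℝ _) (vtx_mem_cellHull hu)
    (vtx_mem_cellHull hv) (vtx_mem_cellHull hw) (area_vtx_ne_zero huv hwu hwv)

/-- Cells with disjoint interiors do not have crossing chords. -/
lemma not_cross_of_interior_disjoint [NeZero n] {c c' : Finset (ZMod n)}
    (hc : 3 ≤ c.card) (hc' : 3 ≤ c'.card)
    (hdisj : interior (cellHull n c) ∩ interior (cellHull n c') = ∅)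
    {u v x y : ZMod n} (hu : u ∈ c) (hv : v ∈ c) (hx : x ∈ c') (hy : y ∈ c')
    (hux : u.val < x.val) (hxv : x.val < v.val) (hvy : v.val < y.val) : False := by
  have hcv : Convex ℝ (cellHull n c) := convex_convexHull ℝ _
  have hcv' : Convex ℝ (cellHull n c') := convex_convexHull ℝ _
  obtain ⟨w, hw, hwu, hwv⟩ := exists_third hc u v
  have hX := area_vtx_between hux hxv
  have hY := area_vtx_outside (u := u) (v := v) (x := y) (by omega) (by omega)
  have hU := area_vtx_outside (u := x) (v := y) (x := u) (by omega) (by omega)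
  have hV := area_vtx_between hxv hvy
  obtain ⟨z, hz, hz'⟩ : ∃ z ∈ cellHull n c', z ∈ interior (cellHull n c) := by
    rcases (area_vtx_ne_zero (hux.trans hxv) hwu hwv).lt_or_gt with h | h
    · refine exists_mem_interior_of_cross hcv hcv' (vtx_mem_cellHull hv) (vtx_mem_cellHull hu)
        (vtx_mem_cellHull hw) (vtx_mem_cellHull hy) (vtx_mem_cellHull hx) ?_ ?_ ?_ ?_ ?_ <;>
      · rw [area_swap]; linarith
    · exact exists_mem_interior_of_cross hcv hcv' (vtx_mem_cellHull hu) (vtx_mem_cellHull hv)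
        (vtx_mem_cellHull hw) (vtx_mem_cellHull hx) (vtx_mem_cellHull hy) h hX hY hU hV
  have := inter_interior_nonempty hcv' (interior_cellHull_nonempty hc' hx hy (by omega)) hz hz'
  rw [hdisj] at this
  exact Set.not_nonempty_empty this

lemma area_nonneg_of_mem_cellHull {c : Finset (ZMod n)} {p q z : ℝ × ℝ}
    (h : ∀ x ∈ c, 0 ≤ area p q (vtx n x)) (hz : z ∈ cellHull n c) : 0 ≤ area p q z := by
  classical
  rw [cellHull, ← Finset.coe_image, Finset.mem_convexHull'] at hz
  obtain ⟨w, hw0, hw1, rfl⟩ := hz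
  rw [area_sum _ w (fun y => y) hw1]
  refine Finset.sum_nonneg fun y hy => mul_nonneg (hw0 y hy) ?_
  obtain ⟨x, hx, rfl⟩ := Finset.mem_image.1 hy
  exact h x hx

/-- A chord that no cell crosses is a side of a cell on each of its sides. -/
lemma exists_cell_on_chord [NeZero n] {T : Finset (Finset (ZMod n))}
    (hcover : (⋃ c ∈ T, cellHull n c) = convexHull ℝ (Set.range (vtx n))) {u v w : ZMod n}
    (huw : u.val < w.val) (hwv : w.val < v.val)
    (hcross : ∀ c ∈ T, ∀ x ∈ c, u.val < x.val → x.val < v.val →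
      ∀ y ∈ c, u.val ≤ y.val ∧ y.val ≤ v.val) :
    ∃ c ∈ T, u ∈ c ∧ v ∈ c ∧ ∀ y ∈ c, u.val ≤ y.val ∧ y.val ≤ v.val := by
  set U := vtx n u
  set V := vtx n v
  set W := vtx n w
  set M : ℝ × ℝ := (1 / 2 : ℝ) • U + (1 / 2 : ℝ) • V with hM
  set f : ℝ → ℝ × ℝ := fun t => (1 - t) • M + t • W with hf
  have hfc : Continuous f := by fun_prop
  have hP : Convex ℝ (convexHull ℝ (Set.range (vtx n))) := convex_convexHull ℝ _
  have hmem : ∀ x, vtx n x ∈ convexHull ℝ (Set.range (vtx n)) := fun x =>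
    subset_convexHull ℝ _ ⟨x, rfl⟩
  have hMP : M ∈ convexHull ℝ (Set.range (vtx n)) :=
    hP (hmem u) (hmem v) (by norm_num) (by norm_num) (by norm_num)
  have hUVM : area U V M = 0 := by
    rw [hM, area_combo _ _ _ _ (by norm_num)]; unfold area; ring
  have hW : area U V W < 0 := area_vtx_between huw hwv
  have h01 : ∀ᶠ t in nhdsWithin (0 : ℝ) (Set.Ioi 0), t ∈ Set.Ioo (0 : ℝ) 1 :=
    Ioo_mem_nhdsGT one_pos
  obtain ⟨c, hcT, hc⟩ : ∃ c ∈ T, ∃ᶠ t in nhdsWithin (0 : ℝ) (Set.Ioi 0), f t ∈ cellHull n c := by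
    by_contra! hcon
    have hall : ∀ᶠ t in nhdsWithin (0 : ℝ) (Set.Ioi 0), ∀ c ∈ T, f t ∉ cellHull n c := by
      rw [Filter.eventually_all_finset]
      intro c hc
      exact hcon c hc
    obtain ⟨t, ht, ht0, ht1⟩ := (hall.and h01).exists
    have : f t ∈ ⋃ c ∈ T, cellHull n c := by
      rw [hcover]
      exact hP hMP (hmem w) (by linarith) ht0.le (by ring)
    simp only [Set.mem_iUnion] at this
    obtain ⟨c, hc, hc'⟩ := this
    exact ht c hc hc'
  have hclosed : IsClosed (cellHull n c) :=
    (((Finset.finite_toSet c).image (vtx n)).isCompact_convexHull ℝ).isClosed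
  have hMc : M ∈ cellHull n c := by
    by_contra hcon
    have : ∀ᶠ t in nhdsWithin (0 : ℝ) (Set.Ioi 0), f t ∈ (cellHull n c)ᶜ := by
      refine Filter.Eventually.filter_mono nhdsWithin_le_nhds ?_
      refine hfc.continuousAt.eventually (hclosed.isOpen_compl.mem_nhds ?_)
      simpa [hf] using hcon
    exact hc this
  obtain ⟨t, htc, ht0, ht1⟩ := (hc.and_eventually h01).exists
  have hft : area U V (f t) < 0 := by
    rw [hf, area_combo _ _ _ _ (by ring), hUVM]
    nlinarith
  obtain ⟨x, hx, hux, hxv⟩ : ∃ x ∈ c, u.val < x.val ∧ x.val < v.val := by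
    by_contra! hcon
    refine hft.not_ge (area_nonneg_of_mem_cellHull (fun x hx => ?_) htc)
    by_cases h : x = u ∨ x = v
    · rcases h with rfl | rfl
      · exact le_of_eq (by unfold area; ring)
      · exact le_of_eq (by unfold area; ring)
    · push Not at h
      have hu' : x.val ≠ u.val := fun e => h.1 (ZMod.val_injective n e)
      have hv' : x.val ≠ v.val := fun e => h.2 (ZMod.val_injective n e)
      refine (area_vtx_outside (huw.trans hwv) ?_).le
      have := hcon x hx
      omega
  have hin := hcross c hcT x hx hux hxv
  have hmid : ∀ a b : ZMod n, a.val < b.val → (∀ y ∈ c, a.val ≤ y.val ∧ y.val ≤ b.val) →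
      area (vtx n a) (vtx n b) M ≤ 0 := by
    intro a b hab h
    have := area_nonneg_of_mem_cellHull (p := vtx n b) (q := vtx n a) (fun y hy => ?_) hMc
    · rw [area_swap] at this
      linarith
    · rw [area_swap]
      by_cases hya : y = a
      · exact le_of_eq (by rw [hya]; unfold area; ring)
      by_cases hyb : y = b
      · exact le_of_eq (by rw [hyb]; unfold area; ring)
      have ha' : y.val ≠ a.val := fun e => hya (ZMod.val_injective n e)
      have hb' : y.val ≠ b.val := fun e => hyb (ZMod.val_injective n e)
      have := area_vtx_between (u := a) (v := b) (x := y) (by grind) (by grind)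
      linarith
  refine ⟨c, hcT, ?_, ?_, hin⟩
  · obtain ⟨a, ha, hmin⟩ := c.exists_min_image ZMod.val ⟨x, hx⟩
    rcases (hin a ha).1.eq_or_lt with h | h
    · rwa [ZMod.val_injective n h]
    · have hav : a.val < v.val := (hmin x hx).trans_lt hxv
      have h1 := hmid a v hav fun y hy => ⟨hmin y hy, (hin y hy).2⟩
      have h2 := area_vtx_outside hav (.inl h)
      have h3 : area (vtx n a) V V = 0 := by unfold area; ring
      rw [hM, area_combo _ _ _ _ (by norm_num), h3] at h1
      linarith
  · obtain ⟨b, hb, hmax⟩ := c.exists_max_image ZMod.val ⟨x, hx⟩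
    rcases (hin b hb).2.eq_or_lt with h | h
    · rwa [← ZMod.val_injective n h]
    · have hub : u.val < b.val := hux.trans_le (hmax x hx)
      have h1 := hmid u b hub fun y hy => ⟨(hin y hy).1, hmax y hy⟩
      have h2 := area_vtx_outside hub (.inr h)
      have h3 : area U (vtx n b) U = 0 := by unfold area; ring
      rw [hM, area_combo _ _ _ _ (by norm_num), h3] at h1
      linarith

end Vertices

section PathCounting

variable {α : Type*} [LinearOrder α]

/-- The vertices of `S` strictly between `i` and `j` in the cyclic order. -/
def cyc (S : Finset α) (i j : α) : Finset α :=
  S.filter fun x => if i < j then i < x ∧ x < j else x < j ∨ i < x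

/-- The vertices in `E`, inserted between the neighbours `a` and `b`, can be the inner vertices of
a new cell glued to the polygon with vertex set `S` along its side `a b`. -/
structure IsEar (d : ℕ) (S : Finset α) (T : Finset (Finset α)) (E : Finset α) (a b : α) :
    Prop where
  le : 3 ≤ d
  left_mem : a ∈ S
  right_mem : b ∈ S
  lt : a < b
  adj : ∀ x ∈ S, a < x → x < b → False
  between : ∀ x ∈ E, a < x ∧ x < b
  card : E.card = d - 2
  subset : ∀ c ∈ T, c ⊆ S

namespace IsEar

variable {d : ℕ} {S E : Finset α} {T : Finset (Finset α)} {a b : α}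

lemma disjoint (h : IsEar d S T E a b) : Disjoint S E := by
  rw [Finset.disjoint_left]
  intro x hx hE
  exact h.adj x hx (h.between x hE).1 (h.between x hE).2

lemma notMem (h : IsEar d S T E a b) {x : α} (hx : x ∈ E) : x ∉ S := fun hS =>
  Finset.disjoint_left.1 h.disjoint hS hx

lemma left_notMem (h : IsEar d S T E a b) : a ∉ E := fun ha => h.notMem ha h.left_mem

lemma right_notMem (h : IsEar d S T E a b) : b ∉ E := fun hb => h.notMem hb h.right_mem

lemma nonempty (h : IsEar d S T E a b) : E.Nonempty := by
  rw [← Finset.card_pos, h.card]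
  have := h.le
  omega

lemma cell_notMem (h : IsEar d S T E a b) : insert a (insert b E) ∉ T := by
  intro hc
  obtain ⟨x, hx⟩ := h.nonempty
  exact h.notMem hx (h.subset _ hc (by simp [hx]))

lemma card_cell (h : IsEar d S T E a b) : (insert a (insert b E)).card = d := by
  rw [Finset.card_insert_of_notMem, Finset.card_insert_of_notMem h.right_notMem, h.card]
  · have := h.le
    omega
  · simp [h.left_notMem, h.lt.ne]

end IsEar

/-- The combinatorial content of a dissection of a polygon with vertex set `S` into `d`-gons. -/
structure IsDissection (d : ℕ) (S : Finset α) (T : Finset (Finset α)) : Prop where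
  card : ∀ c ∈ T, c.card = d
  subset : ∀ c ∈ T, c ⊆ S
  not_cross : ∀ c ∈ T, ∀ c' ∈ T, c ≠ c' → ∀ u ∈ c, ∀ v ∈ c, ∀ x ∈ c', ∀ y ∈ c',
    u < x → x < v → v < y → False
  fill : ∀ c ∈ T, ∀ u ∈ c, ∀ v ∈ c, (∀ x ∈ c, u < x → x < v → False) →
    ∀ w ∈ S, u < w → w < v → ∃ c' ∈ T, u ∈ c' ∧ v ∈ c' ∧ ∀ x ∈ c', u ≤ x ∧ x ≤ v
  root : ∃ lo ∈ S, ∃ hi ∈ S, lo < hi ∧ (∀ x ∈ S, lo ≤ x ∧ x ≤ hi) ∧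
    (2 < S.card → ∃ c ∈ T, lo ∈ c ∧ hi ∈ c)

namespace IsDissection

variable {d : ℕ} {S : Finset α} {T : Finset (Finset α)}

/-- A cell of minimal extent consists of consecutive vertices. -/
lemma exists_consecutive (h : IsDissection d S T) (hd : 3 ≤ d) (hT : T.Nonempty) :
    ∃ c ∈ T, ∃ a ∈ c, ∃ b ∈ c, a < b ∧ ∀ x, x ∈ c ↔ x ∈ S ∧ a ≤ x ∧ x ≤ b := by
  set ext : Finset α → Finset α := fun c => S.filter fun x => (∃ u ∈ c, u ≤ x) ∧ ∃ v ∈ c, x ≤ v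
  obtain ⟨c, hc, hmin⟩ := T.exists_min_image (fun c => (ext c).card) hT
  have hcard := h.card c hc
  have hne : c.Nonempty := by
    rw [← Finset.card_pos]; omega
  refine ⟨c, hc, c.min' hne, c.min'_mem hne, c.max' hne, c.max'_mem hne,
    Finset.min'_lt_max'_of_card c (by omega), fun w => ⟨fun hw => ⟨h.subset c hc hw,
      c.min'_le w hw, c.le_max' w hw⟩, ?_⟩⟩
  rintro ⟨hwS, hw1, hw2⟩
  by_contra hwc
  have hlo : (c.filter (· < w)).Nonempty :=
    ⟨c.min' hne, Finset.mem_filter.2 ⟨c.min'_mem hne, lt_of_le_of_ne hw1 fun e =>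
      hwc (e ▸ c.min'_mem hne)⟩⟩
  have hhi : (c.filter (w < ·)).Nonempty :=
    ⟨c.max' hne, Finset.mem_filter.2 ⟨c.max'_mem hne, lt_of_le_of_ne hw2 fun e =>
      hwc (e ▸ c.max'_mem hne)⟩⟩
  obtain ⟨u, hu, humax⟩ := Finset.exists_max_image _ id hlo
  obtain ⟨v, hv, hvmin⟩ := Finset.exists_min_image _ id hhi
  simp only [Finset.mem_filter, id] at hu humax hv hvmin
  have hbetween : ∀ x ∈ c, u < x → x < v → False := by
    intro x hx hux hxv
    rcases lt_trichotomy x w with hxw | rfl | hxw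
    · exact (humax x ⟨hx, hxw⟩).not_gt hux
    · exact hwc hx
    · exact (hvmin x ⟨hx, hxw⟩).not_gt hxv
  obtain ⟨c', hc', huc', hvc', hin⟩ := h.fill c hc u hu.1 v hv.1 hbetween w hwS hu.2 hv.2
  obtain ⟨y, hy, hyuv⟩ : ∃ y ∈ c, y ∉ ({u, v} : Finset α) :=
    Finset.exists_mem_notMem_of_card_lt_card (lt_of_le_of_lt Finset.card_le_two (by omega))
  simp only [Finset.mem_insert, Finset.mem_singleton, not_or] at hyuv
  refine (hmin c' hc').not_gt (Finset.card_lt_card ⟨?_, ?_⟩)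
  · intro x hx
    simp only [ext, Finset.mem_filter] at hx ⊢
    obtain ⟨hxS, ⟨p, hp, hpx⟩, q, hq, hxq⟩ := hx
    exact ⟨hxS, ⟨u, hu.1, (hin p hp).1.trans hpx⟩, v, hv.1, hxq.trans (hin q hq).2⟩
  · intro hs
    have hyc : y ∈ ext c := Finset.mem_filter.2 ⟨h.subset c hc hy, ⟨y, hy, le_rfl⟩, y, hy, le_rfl⟩
    obtain ⟨-, ⟨p, hp, hpy⟩, q, hq, hyq⟩ := Finset.mem_filter.1 (hs hyc)
    exact hbetween y hy (lt_of_le_of_ne ((hin p hp).1.trans hpy) (Ne.symm hyuv.1))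
      (lt_of_le_of_ne (hyq.trans (hin q hq).2) hyuv.2)

/-- A nonempty dissection is obtained by gluing an ear to a smaller dissection. -/
lemma exists_ear (h : IsDissection d S T) (hd : 3 ≤ d) (hT : T.Nonempty) :
    ∃ S' T' E a b, IsDissection d S' T' ∧ IsEar d S' T' E a b ∧ S = S' ∪ E ∧
      T = insert (insert a (insert b E)) T' := by
  obtain ⟨c, hc, a, ha, b, hb, hab, hmem⟩ := h.exists_consecutive hd hT
  have haS := h.subset c hc ha
  have hbS := h.subset c hc hb
  have hcell : insert a (insert b (c \ {a, b})) = c := by grind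
  have hother : ∀ c' ∈ T, c' ≠ c → ∀ x ∈ c', x ∈ c → x = a ∨ x = b := by
    intro c' hc' hne x hx hxc
    by_contra hcon
    push Not at hcon
    have hx' := (hmem x).1 hxc
    have hax : a < x := lt_of_le_of_ne hx'.2.1 (Ne.symm hcon.1)
    have hxb : x < b := lt_of_le_of_ne hx'.2.2 hcon.2
    refine hne (Finset.eq_of_subset_of_card_le (fun y hy => ?_)
      ((h.card c hc).trans (h.card c' hc').symm).le)
    rw [hmem]
    refine ⟨h.subset c' hc' hy, ?_, ?_⟩
    · by_contra! hya
      exact h.not_cross c' hc' c hc hne y hy x hx a ha b hb hya hax hxb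
    · by_contra! hby
      exact h.not_cross c hc c' hc' hne.symm a ha b hb x hx y hy hax hxb hby
  refine ⟨S \ (c \ {a, b}), T.erase c, c \ {a, b}, a, b, ?_, ?_, ?_, ?_⟩
  · refine ⟨fun c' hc' => h.card c' (Finset.mem_of_mem_erase hc'), ?_, ?_, ?_, ?_⟩
    · intro c' hc' x hx
      rw [Finset.mem_erase] at hc'
      have := hother c' hc'.2 hc'.1 x hx
      have := h.subset c' hc'.2 hx
      grind
    · intro c₁ h₁ c₂ h₂
      exact h.not_cross c₁ (Finset.mem_of_mem_erase h₁) c₂ (Finset.mem_of_mem_erase h₂)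
    · intro c' hc' u hu v hv hbet w hw huw hwv
      obtain ⟨c'', hc'', hu', hv', hin⟩ := h.fill c' (Finset.mem_of_mem_erase hc') u hu v hv hbet w
        (Finset.sdiff_subset hw) huw hwv
      refine ⟨c'', Finset.mem_erase.2 ⟨?_, hc''⟩, hu', hv', hin⟩
      rintro rfl
      have := hin a ha
      have := hin b hb
      have := hmem w
      have := hmem u
      have := hmem v
      grind
    · obtain ⟨lo, hlo, hi, hhi, hlt, hall, hroot⟩ := h.root
      have hnot : ∀ x ∈ S, (x = lo ∨ x = hi) → x ∈ S \ (c \ {a, b}) := by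
        intro x hx hx'
        have := hall a haS
        have := hall b hbS
        have := hmem x
        grind
      refine ⟨lo, hnot lo hlo (.inl rfl), hi, hnot hi hhi (.inr rfl), hlt,
        fun x hx => hall x (Finset.sdiff_subset hx), fun h2 => ?_⟩
      obtain ⟨c', hc', hloc, hhic⟩ := hroot (h2.trans_le (Finset.card_le_card Finset.sdiff_subset))
      refine ⟨c', Finset.mem_erase.2 ⟨?_, hc'⟩, hloc, hhic⟩
      rintro rfl
      have hsub : S \ (c' \ {a, b}) ⊆ {a, b} := by
        intro x hx
        rw [Finset.mem_sdiff] at hx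
        have := hall x hx.1
        have := (hmem lo).1 hloc
        have := (hmem hi).1 hhic
        have := hmem x
        grind
      have := (Finset.card_le_card hsub).trans Finset.card_le_two
      omega
  · refine ⟨hd, by grind, by grind, hab, ?_, ?_, ?_, ?_⟩
    · intro x hx hax hxb
      have := hmem x
      grind
    · intro x hx
      have := hmem x
      grind
    · rw [Finset.card_sdiff_of_subset (by grind), Finset.card_pair hab.ne, h.card c hc]
    · intro c' hc' x hx
      rw [Finset.mem_erase] at hc'
      have := hother c' hc'.2 hc'.1 x hx
      have := h.subset c' hc'.2 hx
      grind
  · rw [Finset.sdiff_union_of_subset]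
    exact Finset.sdiff_subset.trans (h.subset c hc)
  · rw [hcell, Finset.insert_erase hc]

end IsDissection

variable [Fintype α]

/-- Assignments of an incident cell of `T` to each vertex in `A`, using each cell at most `d - 2`
times, extended by `∅` outside `A`. -/
def pathAssignments (d : ℕ) (T : Finset (Finset α)) (A : Finset α) : Finset (α → Finset α) :=
  {f | (∀ v ∉ A, f v = ∅) ∧ (∀ v ∈ A, f v ∈ T ∧ v ∈ f v) ∧
    ∀ c ∈ T, (A.filter fun v => f v = c).card ≤ d - 2}

/-- The number of path assignments on `A`. -/
def pathNum (d : ℕ) (T : Finset (Finset α)) (A : Finset α) : ℕ := (pathAssignments d T A).card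

lemma mem_pathAssignments {d : ℕ} {T : Finset (Finset α)} {A : Finset α} {f : α → Finset α} :
    f ∈ pathAssignments d T A ↔ (∀ v ∉ A, f v = ∅) ∧ (∀ v ∈ A, f v ∈ T ∧ v ∈ f v) ∧
      ∀ c ∈ T, (A.filter fun v => f v = c).card ≤ d - 2 := by
  simp [pathAssignments]

/-- Sorting the assignments by the set of vertices to which the cell `c` is assigned. -/
lemma pathNum_insert (d : ℕ) {T : Finset (Finset α)} {c : Finset α} (hc : c ∉ T) (A : Finset α) :
    pathNum d (insert c T) A =
      ∑ X ∈ (A ∩ c).powerset.filter (fun X => X.card ≤ d - 2), pathNum d T (A \ X) := by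
  rw [pathNum, Finset.card_eq_sum_card_fiberwise (f := fun f => A.filter fun v => f v = c)
    (t := (A ∩ c).powerset.filter (fun X => X.card ≤ d - 2))]
  · refine Finset.sum_congr rfl fun X hX => ?_
    simp only [Finset.mem_filter, Finset.mem_powerset] at hX
    obtain ⟨hXA, hXd⟩ := hX
    refine Finset.card_nbij' (fun f v => if v ∈ X then ∅ else f v)
      (fun g v => if v ∈ X then c else g v) ?_ ?_ ?_ ?_
    · intro f hf
      simp only [Finset.coe_filter, Set.mem_ofPred_eq, mem_pathAssignments] at hf
      obtain ⟨⟨h0, h1, h2⟩, rfl⟩ := hf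
      simp only [Finset.mem_coe, mem_pathAssignments]
      refine ⟨?_, ?_, ?_⟩
      · intro v hv; simp at hv ⊢; grind
      · intro v hv
        simp at hv
        have := h1 v hv.1
        simp at this
        simp [hv.1, hv.2 hv.1, this.2]
        grind
      · intro e he
        refine le_trans (Finset.card_le_card ?_) (h2 e (Finset.mem_insert_of_mem he))
        intro v hv
        simp at hv ⊢
        grind
    · intro g hg
      simp only [Finset.mem_coe, mem_pathAssignments] at hg
      obtain ⟨h0, h1, h2⟩ := hg
      simp only [Finset.coe_filter, Set.mem_ofPred_eq, mem_pathAssignments]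
      have hfib : (A.filter fun v => (if v ∈ X then c else g v) = c) = X := by
        ext v
        simp only [Finset.mem_filter]
        have := h1 v
        have := @hXA v
        grind
      refine ⟨⟨?_, ?_, ?_⟩, hfib⟩
      · intro v hv
        have := h0 v
        have := @hXA v
        grind
      · intro v hv
        have := h1 v
        have := @hXA v
        grind
      · intro e he
        rcases Finset.mem_insert.1 he with rfl | he
        · rwa [hfib]
        · refine le_trans (Finset.card_le_card ?_) (h2 e he)
          intro v hv
          simp only [Finset.mem_filter, Finset.mem_sdiff] at hv ⊢
          grind
    · intro f hf
      simp only [Finset.coe_filter, Set.mem_ofPred_eq, mem_pathAssignments] at hf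
      obtain ⟨-, rfl⟩ := hf
      funext v
      grind
    · intro g hg
      simp only [Finset.mem_coe, mem_pathAssignments] at hg
      funext v
      have := hg.1 v
      grind
  · intro f hf
    rw [Finset.mem_coe, mem_pathAssignments] at hf
    simp only [Finset.coe_filter, Set.mem_ofPred_eq, Finset.mem_powerset]
    refine ⟨fun v hv => ?_, hf.2.2 c (Finset.mem_insert_self _ _)⟩
    have := hf.2.1 v
    grind

lemma pathNum_empty (d : ℕ) (T : Finset (Finset α)) : pathNum d T ∅ = 1 := by
  rw [pathNum, Finset.card_eq_one]
  refine ⟨fun _ => ∅, ?_⟩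
  ext f
  simp [mem_pathAssignments, funext_iff]

lemma pathNum_eq_zero_of_notMem (d : ℕ) {T : Finset (Finset α)} {A : Finset α} {v : α}
    (hv : v ∈ A) (h : ∀ c ∈ T, v ∉ c) : pathNum d T A = 0 := by
  rw [pathNum, Finset.card_eq_zero, Finset.eq_empty_iff_forall_notMem]
  intro f hf
  obtain ⟨h1, h2⟩ := (mem_pathAssignments.1 hf).2.1 v hv
  exact h _ h1 h2

lemma pathNum_eq_zero_of_card_lt (d : ℕ) {T : Finset (Finset α)} {A : Finset α}
    (h : T.card * (d - 2) < A.card) : pathNum d T A = 0 := by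
  rw [pathNum, Finset.card_eq_zero, Finset.eq_empty_iff_forall_notMem]
  intro f hf
  obtain ⟨-, h1, h2⟩ := mem_pathAssignments.1 hf
  refine h.not_ge ?_
  rw [Finset.card_eq_sum_card_fiberwise (f := f) (t := T) fun v hv => (h1 v hv).1]
  exact Finset.sum_le_card_nsmul _ _ _ h2

/-- The matrix of path numbers of the polygon with vertex set `S`. -/
def pathMat (d : ℕ) (S : Finset α) (T : Finset (Finset α)) : Matrix S S ℤ :=
  Matrix.of fun i j => (pathNum d T (cyc S i j) : ℤ)

namespace IsEar

variable {d : ℕ} {S E : Finset α} {T : Finset (Finset α)} {a b : α}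

lemma pathNum_eq_zero (h : IsEar d S T E a b) {A : Finset α} {x : α} (hx : x ∈ E) (hA : x ∈ A) :
    pathNum d T A = 0 :=
  pathNum_eq_zero_of_notMem d hA fun c hc hxc => h.notMem hx (h.subset c hc hxc)

/-- If the inner vertices of the ear exhaust it, or neither `a` nor `b` is visited, then the ear
does not contribute. -/
lemma pathNum_eq (h : IsEar d S T E a b) {A : Finset α} (hA : E ⊆ A ∨ (a ∉ A ∧ b ∉ A)) :
    pathNum d (insert (insert a (insert b E)) T) A = pathNum d T (A \ E) := by
  rw [pathNum_insert d h.cell_notMem, Finset.sum_eq_single (A ∩ E)]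
  · rw [Finset.sdiff_inter_self_left]
  · intro X hX hne
    simp only [Finset.mem_filter, Finset.mem_powerset] at hX
    by_cases hsub : A ∩ E ⊆ X
    · exfalso
      rcases hA with hA | ⟨ha, hb⟩
      · rw [Finset.inter_eq_right.2 hA] at hsub hne
        exact hne (Finset.eq_of_subset_of_card_le hsub (by rw [h.card]; exact hX.2)).symm
      · refine hne (Finset.Subset.antisymm (fun x hx => ?_) hsub)
        have := hX.1 hx
        grind
    · obtain ⟨x, hx, hxX⟩ := Finset.not_subset.1 hsub
      rw [Finset.mem_inter] at hx
      exact h.pathNum_eq_zero hx.2 (Finset.mem_sdiff.2 ⟨hx.1, hxX⟩)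
  · intro hn
    exfalso
    apply hn
    simp only [Finset.mem_filter, Finset.mem_powerset]
    refine ⟨?_, (Finset.card_le_card Finset.inter_subset_right).trans h.card.le⟩
    exact Finset.inter_subset_inter_left (by grind)

/-- If exactly one end `e` of the glued side is visited, and not all inner vertices of the ear are,
then `e` may or may not be assigned to the ear. -/
lemma pathNum_eq_add (h : IsEar d S T E a b) {A : Finset α} {e f : α}
    (hef : e = a ∧ f = b ∨ e = b ∧ f = a) (he : e ∈ A) (hf : f ∉ A) (hA : ¬ E ⊆ A) :
    pathNum d (insert (insert a (insert b E)) T) A =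
      pathNum d T (A \ E) + pathNum d T ((A \ E).erase e) := by
  have heE : e ∉ E := by
    have := h.left_notMem
    have := h.right_notMem
    grind
  have hne : A ∩ E ≠ insert e (A ∩ E) := fun hh => by
    have : e ∈ A ∩ E := by rw [hh]; simp
    exact heE (Finset.mem_inter.1 this).2
  have hlt : (A ∩ E).card < d - 2 := by
    rw [← h.card]
    refine Finset.card_lt_card ⟨Finset.inter_subset_right, fun hs => hA fun x hx => ?_⟩
    exact (Finset.mem_inter.1 (hs hx)).1
  have hsub : ({A ∩ E, insert e (A ∩ E)} : Finset (Finset α)) ⊆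
      (A ∩ insert a (insert b E)).powerset.filter (fun X => X.card ≤ d - 2) := by
    intro X hX
    simp only [Finset.mem_insert, Finset.mem_singleton] at hX
    simp only [Finset.mem_filter, Finset.mem_powerset]
    rcases hX with rfl | rfl
    · exact ⟨by grind, hlt.le⟩
    · exact ⟨by grind, (Finset.card_insert_le _ _).trans hlt⟩
  rw [pathNum_insert d h.cell_notMem, ← Finset.sum_subset hsub, Finset.sum_pair hne]
  · congr 2 <;> grind
  · intro X hX hX'
    simp only [Finset.mem_filter, Finset.mem_powerset] at hX
    simp only [Finset.mem_insert, Finset.mem_singleton, not_or] at hX'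
    by_cases hsub : A ∩ E ⊆ X
    · exfalso
      by_cases heX : e ∈ X
      · refine hX'.2 (Finset.Subset.antisymm (fun x hx => ?_) ?_)
        · have := hX.1 hx
          grind
        · exact Finset.insert_subset heX hsub
      · refine hX'.1 (Finset.Subset.antisymm (fun x hx => ?_) hsub)
        have := hX.1 hx
        grind
    · obtain ⟨x, hx, hxX⟩ := Finset.not_subset.1 hsub
      rw [Finset.mem_inter] at hx
      exact h.pathNum_eq_zero hx.2 (Finset.mem_sdiff.2 ⟨hx.1, hxX⟩)

/-- If all vertices outside of the ear are visited, then they exhaust the remaining cells, so the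
visited vertices of the ear are assigned to it. -/
lemma pathNum_eq_one (h : IsEar d S T E a b) (hS : S.card = 2 + T.card * (d - 2))
    (hab : pathNum d T (S \ {a, b}) = 1) {A : Finset α} (hA : S \ {a, b} ⊆ A) (hA' : A ⊆ S ∪ E)
    (hcard : (A ∩ insert a (insert b E)).card ≤ d - 2) :
    pathNum d (insert (insert a (insert b E)) T) A = 1 := by
  have hSab : (S \ {a, b}).card = T.card * (d - 2) := by
    rw [Finset.card_sdiff_of_subset, Finset.card_pair h.lt.ne, hS]
    · omega
    · have := h.left_mem
      have := h.right_mem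
      grind
  have hdis := h.disjoint
  have hE : ∀ x ∈ E, x ∉ S := fun x hx => h.notMem hx
  have hrest : A \ (A ∩ insert a (insert b E)) = S \ {a, b} := by
    ext x
    have := @hA x
    have := @hA' x
    have := hE x
    grind
  rw [pathNum_insert d h.cell_notMem, Finset.sum_eq_single (A ∩ insert a (insert b E)),
    hrest, hab]
  · intro X hX hne
    simp only [Finset.mem_filter, Finset.mem_powerset] at hX
    apply pathNum_eq_zero_of_card_lt
    rw [← hSab, ← hrest]
    refine Finset.card_lt_card ⟨Finset.sdiff_subset_sdiff le_rfl hX.1, fun hs => hne ?_⟩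
    refine Finset.Subset.antisymm hX.1 fun x hx => ?_
    by_contra hxX
    have := hs (Finset.mem_sdiff.2 ⟨(Finset.mem_inter.1 hx).1, hxX⟩)
    exact (Finset.mem_sdiff.1 this).2 hx
  · intro hn
    exact absurd (Finset.mem_filter.2 ⟨Finset.mem_powerset_self _, hcard⟩) hn

/-- Sides of the polygon have path number one also after gluing the ear. -/
lemma pathNum_side (h : IsEar d S T E a b) (hS : S.card = 2 + T.card * (d - 2))
    (hside : ∀ u ∈ S, ∀ v ∈ S, u < v → (∀ x ∈ S, u < x → x < v → False) →
      pathNum d T (S \ {u, v}) = 1)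
    {u v : α} (hu : u ∈ S ∪ E) (hv : v ∈ S ∪ E) (huv : u < v)
    (hadj : ∀ x ∈ S ∪ E, u < x → x < v → False) :
    pathNum d (insert (insert a (insert b E)) T) ((S ∪ E) \ {u, v}) = 1 := by
  have ha := h.left_mem
  have hb := h.right_mem
  have hab := hside a h.left_mem b h.right_mem h.lt h.adj
  have hbetween := h.between
  have hE : ∀ x ∈ E, x ∉ S := fun x hx => h.notMem hx
  by_cases hmem : u ∈ insert a (insert b E) ∧ v ∈ insert a (insert b E)
  · refine h.pathNum_eq_one hS hab (fun x hx => ?_) Finset.sdiff_subset ?_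
    · have := hE x
      grind
    · have : ((S ∪ E) \ {u, v}) ∩ insert a (insert b E) ⊆ insert a (insert b E) \ {u, v} := by
        grind
      refine (Finset.card_le_card this).trans ?_
      rw [Finset.card_sdiff_of_subset, Finset.card_pair huv.ne, h.card_cell]
      grind
  · have huE : u ∉ E := fun hu' => by
      have := hadj b (by simp [hb]) (hbetween u hu').2
      have := hbetween u hu'
      have := h.adj v
      grind
    have hvE : v ∉ E := fun hv' => by
      have := hadj a (by simp [ha])
      have := hbetween v hv'
      have := h.adj u
      grind
    rw [h.pathNum_eq (.inl ?_)]
    · rw [← hside u (by grind) v (by grind) huv fun x hx => hadj x (by simp [hx])]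
      congr 1
      grind
    · intro x hx
      grind

/-- Path numbers ending at an inner vertex of the ear. -/
lemma pathNum_left (h : IsEar d S T E a b) {i k : α} (hi : i ∈ S) (hk : k ∈ E)
    (hS : S.card = 2 + T.card * (d - 2)) :
    pathNum d (insert (insert a (insert b E)) T) (cyc (S ∪ E) i k) =
      pathNum d T (cyc S i a) + pathNum d T (cyc S i b) := by
  have ha := h.left_mem
  have hb := h.right_mem
  have hlt := h.lt
  have hbetween := h.between
  have hkab := hbetween k hk
  have hE : ∀ x ∈ E, x ∉ S := fun x hx => h.notMem hx
  have hadj := h.adj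
  have haE := h.left_notMem
  by_cases hia : i = a
  · subst hia
    have h0 : pathNum d T (cyc S i i) = 0 := by
      apply pathNum_eq_zero_of_card_lt
      have : cyc S i i = S.erase i := by
        ext x
        simp only [cyc, Finset.mem_filter, lt_irrefl, if_false, Finset.mem_erase]
        grind
      rw [this, Finset.card_erase_of_mem ha]
      omega
    have h1 : cyc S i b = ∅ := by
      ext x
      simp only [cyc, Finset.mem_filter]
      grind
    have h2 : cyc (S ∪ E) i k \ E = ∅ := by
      ext x
      simp only [cyc, Finset.mem_filter, Finset.mem_sdiff, Finset.mem_union]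
      grind
    rw [h0, h1, h.pathNum_eq (.inr ?_), h2, zero_add]
    simp only [cyc, Finset.mem_filter]
    grind
  · have hi' : i < a ∨ b ≤ i := by
      have := hadj i hi
      grind
    rw [h.pathNum_eq_add (e := a) (f := b) (.inl ⟨rfl, rfl⟩), add_comm]
    · congr 2
      · ext x
        have := hE x
        have := hbetween x
        have := hadj x
        simp only [cyc, Finset.mem_filter, Finset.mem_sdiff, Finset.mem_union, Finset.mem_erase]
        grind
      · ext x
        have := hE x
        have := hbetween x
        have := hadj x
        simp only [cyc, Finset.mem_filter, Finset.mem_sdiff, Finset.mem_union]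
        grind
    · simp only [cyc, Finset.mem_filter, Finset.mem_union]
      grind
    · simp only [cyc, Finset.mem_filter, Finset.mem_union]
      grind
    · intro hs
      have := hs hk
      simp only [cyc, Finset.mem_filter] at this
      grind

lemma pathNum_old (h : IsEar d S T E a b) {i j : α} (hi : i ∈ S) (hj : j ∈ S) :
    pathNum d (insert (insert a (insert b E)) T) (cyc (S ∪ E) i j) =
      pathNum d T (cyc S i j) := by
  have ha := h.left_mem
  have hb := h.right_mem
  have hlt := h.lt
  have hbetween := h.between
  have hE : ∀ x ∈ E, x ∉ S := fun x hx => h.notMem hx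
  have hi' := h.adj i hi
  have hj' := h.adj j hj
  rw [h.pathNum_eq]
  · congr 1
    ext x
    have := hE x
    simp only [cyc, Finset.mem_filter, Finset.mem_sdiff, Finset.mem_union]
    grind
  · by_cases hab : a ∈ cyc (S ∪ E) i j ∨ b ∈ cyc (S ∪ E) i j
    · left
      intro x hx
      have := hbetween x hx
      simp only [cyc, Finset.mem_filter, Finset.mem_union] at hab ⊢
      grind
    · exact .inr (not_or.1 hab)

lemma pathNum_right (h : IsEar d S T E a b) {l : α} (hl : l ∈ E) :
    pathNum d (insert (insert a (insert b E)) T) (cyc (S ∪ E) l b) = 1 := by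
  have hl' := h.between l hl
  have hadj := h.adj
  have haE := h.left_notMem
  rw [h.pathNum_eq (.inr _), ← pathNum_empty d T]
  · congr 1
    ext x
    have := h.adj x
    simp only [cyc, Finset.mem_filter, Finset.mem_sdiff, Finset.mem_union]
    grind
  · simp only [cyc, Finset.mem_filter]
    grind

/-- Path numbers starting at an inner vertex `l` of the ear and leaving the ear. -/
lemma pathNum_around (h : IsEar d S T E a b) (hS : S.card = 2 + T.card * (d - 2))
    (hab : pathNum d T (S \ {a, b}) = 1) {l k : α} (hl : l ∈ E) (hk : k = a ∨ k ∈ E)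
    (hkl : k < l) :
    pathNum d (insert (insert a (insert b E)) T) (cyc (S ∪ E) l k) = 1 := by
  have hl' := h.between l hl
  have hbetween := h.between
  have hkb : k = a ∨ a < k := by grind
  refine h.pathNum_eq_one hS hab (fun x hx => ?_) (Finset.filter_subset _ _) ?_
  · have := h.adj x
    simp only [cyc, Finset.mem_filter, Finset.mem_union]
    grind
  · have hsub : cyc (S ∪ E) l k ∩ insert a (insert b E) ⊆ insert a (insert b E) \ {l, k} := by
      intro x hx
      simp only [cyc, Finset.mem_filter, Finset.mem_inter] at hx
      grind
    refine (Finset.card_le_card hsub).trans ?_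
    rw [Finset.card_sdiff_of_subset, Finset.card_pair hkl.ne', h.card_cell]
    grind

/-- Path numbers between inner vertices of the ear. -/
lemma pathNum_inner (h : IsEar d S T E a b) (hS : S.card = 2 + T.card * (d - 2))
    (hab : pathNum d T (S \ {a, b}) = 1) {l k : α} (hl : l ∈ E) (hk : k ∈ E) :
    pathNum d (insert (insert a (insert b E)) T) (cyc (S ∪ E) l k) = if l = k then 0 else 1 := by
  have hl' := h.between l hl
  have hk' := h.between k hk
  rcases lt_trichotomy l k with hlk | rfl | hlk
  · rw [if_neg hlk.ne, h.pathNum_eq (.inr _), ← pathNum_empty d T]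
    · congr 1
      ext x
      have := h.adj x
      simp only [cyc, Finset.mem_filter, Finset.mem_sdiff, Finset.mem_union]
      grind
    · simp only [cyc, Finset.mem_filter]
      grind
  · rw [if_pos rfl]
    apply pathNum_eq_zero_of_card_lt
    have : cyc (S ∪ E) l l = (S ∪ E).erase l := by
      ext x
      simp only [cyc, Finset.mem_filter, lt_irrefl, if_false, Finset.mem_erase]
      grind
    rw [this, Finset.card_erase_of_mem (by simp [hl]), Finset.card_union_of_disjoint h.disjoint,
      Finset.card_insert_of_notMem h.cell_notMem, hS, h.card, add_mul]
    omega
  · rw [if_neg hlk.ne', h.pathNum_around hS hab hl (.inr hk) hlk]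

end IsEar

lemma det_one_add_ones {ι : Type*} [Fintype ι] [DecidableEq ι] (z : ℤ) :
    (1 + Matrix.of fun _ _ : ι => z).det = 1 + Fintype.card ι * z := by
  have h : (Matrix.of fun _ _ : ι => z) = Matrix.replicateCol Unit (fun _ : ι => (1 : ℤ)) *
      Matrix.replicateRow Unit (fun _ : ι => z) := by
    ext i j
    simp [Matrix.mul_apply]
  rw [h, Matrix.det_one_add_replicateCol_mul_replicateRow]
  simp [dotProduct]

lemma mul_pair_apply {l m n : Type*} [Fintype m] [DecidableEq m] (A : Matrix l m ℤ) {x y : m}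
    (hxy : x ≠ y) (i : l) (k : n) :
    (A * Matrix.of fun t (_ : n) => if t = x ∨ t = y then (1 : ℤ) else 0) i k = A i x + A i y := by
  rw [Matrix.mul_apply, ← Finset.sum_subset (Finset.subset_univ {x, y}), Finset.sum_pair hxy]
  · simp
  · intro t _ ht
    simp only [Finset.mem_insert, Finset.mem_singleton] at ht
    simp [ht]

/-- Subtracting from the last columns combinations of the first ones. -/
lemma det_fromBlocks_mul {m n : Type*} [Fintype m] [Fintype n] [DecidableEq m] [DecidableEq n]
    (A : Matrix m m ℤ) (P : Matrix m n ℤ) (C : Matrix n m ℤ) (D : Matrix n n ℤ) :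
    (Matrix.fromBlocks A (A * P) C D).det = A.det * (D - C * P).det := by
  have : Matrix.fromBlocks A (A * P) C D =
      Matrix.fromBlocks A 0 C (D - C * P) * Matrix.fromBlocks 1 P 0 1 := by
    rw [Matrix.fromBlocks_multiply]
    simp
  rw [this, Matrix.det_mul, Matrix.det_fromBlocks_zero₁₂, Matrix.det_fromBlocks_zero₂₁]
  simp

lemma IsEar.det_pathMat {d : ℕ} {S E : Finset α} {T : Finset (Finset α)} {a b : α}
    (h : IsEar d S T E a b) (hS : S.card = 2 + T.card * (d - 2))
    (hab : pathNum d T (S \ {a, b}) = 1) :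
    (pathMat d (S ∪ E) (insert (insert a (insert b E)) T)).det =
      (pathMat d S T).det * ((-1) ^ (d - 2) * (d - 1)) := by
  set M := pathMat d (S ∪ E) (insert (insert a (insert b E)) T) with hM
  set e : S ⊕ E ≃ ↥(S ∪ E) := Equiv.Finset.union S E h.disjoint
  have hne : (⟨a, h.left_mem⟩ : S) ≠ ⟨b, h.right_mem⟩ := by simp [h.lt.ne]
  set P : Matrix S E ℤ := Matrix.of fun i _ =>
    if i = ⟨a, h.left_mem⟩ ∨ i = ⟨b, h.right_mem⟩ then 1 else 0 with hP
  set C : Matrix E S ℤ := Matrix.of fun l i => M (e (.inr l)) (e (.inl i)) with hC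
  set D : Matrix E E ℤ := Matrix.of fun l k => M (e (.inr l)) (e (.inr k)) with hD
  have hblock : M.submatrix e e = Matrix.fromBlocks (pathMat d S T) (pathMat d S T * P) C D := by
    ext i j
    rcases i with i | i <;> rcases j with j | j
    · simp only [Matrix.submatrix_apply, Matrix.fromBlocks_apply₁₁]
      exact congrArg Nat.cast (h.pathNum_old i.2 j.2)
    · simp only [Matrix.submatrix_apply, Matrix.fromBlocks_apply₁₂, hP, mul_pair_apply _ hne]
      exact (congrArg Nat.cast (h.pathNum_left i.2 j.2 hS)).trans (Nat.cast_add _ _)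
    · rfl
    · rfl
  have hschur : D - C * P = -(1 + Matrix.of fun _ _ : E => (1 : ℤ)) := by
    ext l k
    have h1 : C l ⟨a, h.left_mem⟩ = 1 :=
      (congrArg Nat.cast (h.pathNum_around hS hab l.2 (.inl rfl) (h.between l l.2).1)).trans
        Nat.cast_one
    have h2 : C l ⟨b, h.right_mem⟩ = 1 :=
      (congrArg Nat.cast (h.pathNum_right l.2)).trans Nat.cast_one
    have h3 : D l k = if l = k then 0 else 1 := by
      refine (congrArg Nat.cast (h.pathNum_inner hS hab l.2 k.2)).trans ?_
      rw [Nat.cast_ite, Nat.cast_zero, Nat.cast_one]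
      exact if_congr Subtype.ext_iff.symm rfl rfl
    rw [Matrix.sub_apply, hP, mul_pair_apply _ hne, h1, h2, h3, Matrix.neg_apply, Matrix.add_apply, Matrix.one_apply]
    split_ifs <;> simp
  rw [← Matrix.det_submatrix_equiv_self e, hblock, det_fromBlocks_mul, hschur, Matrix.det_neg,
    det_one_add_ones, Fintype.card_coe, h.card]
  have := h.le
  push_cast [show 2 ≤ d by omega]
  ring

namespace IsDissection

lemma card_pathNum_det {d : ℕ} (hd : 3 ≤ d) (k : ℕ) : ∀ (S : Finset α) (T : Finset (Finset α)),
    IsDissection d S T → T.card = k →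
    S.card = 2 + k * (d - 2) ∧
    (∀ u ∈ S, ∀ v ∈ S, u < v → (∀ x ∈ S, u < x → x < v → False) →
      pathNum d T (S \ {u, v}) = 1) ∧
    (pathMat d S T).det = (-1) ^ (S.card - 1) * (d - 1) ^ k := by
  induction k with
  | zero =>
    intro S T h hT
    rw [Finset.card_eq_zero] at hT
    subst hT
    obtain ⟨lo, hlo, hi, hhi, hlt, hall, hroot⟩ := h.root
    have hsub : {lo, hi} ⊆ S := by grind
    have hcard : S.card = 2 := by
      have h1 := Finset.card_le_card hsub
      rw [Finset.card_pair hlt.ne] at h1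
      by_contra hne
      obtain ⟨c, hc, -⟩ := hroot (by omega)
      simp at hc
    obtain rfl : {lo, hi} = S := Finset.eq_of_subset_of_card_le hsub
      (by rw [hcard, Finset.card_pair hlt.ne])
    refine ⟨by simpa using hcard, ?_, ?_⟩
    · intro u hu v hv huv _
      rw [← pathNum_empty d (∅ : Finset (Finset α))]
      congr 1
      grind
    · have hmat : pathMat d {lo, hi} ∅ =
          -(1 + Matrix.of fun _ _ : ({lo, hi} : Finset α) => (-1 : ℤ)) := by
        ext i j
        simp only [pathMat, Matrix.of_apply, Matrix.neg_apply, Matrix.add_apply, Matrix.one_apply]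
        by_cases hij : i = j
        · subst hij
          obtain ⟨x, hx, hxi⟩ : ∃ x ∈ ({lo, hi} : Finset α), x ≠ i := by
            rcases eq_or_ne lo i with e | e
            · exact ⟨hi, by simp, e ▸ hlt.ne'⟩
            · exact ⟨lo, by simp, e⟩
          rw [pathNum_eq_zero_of_notMem d (v := x) _ (by simp)]
          · simp
          · simp only [cyc, Finset.mem_filter, lt_irrefl, if_false]
            exact ⟨hx, lt_or_gt_of_ne hxi⟩
        · have : cyc {lo, hi} (i : α) j = ∅ := by
            have h1 := i.2
            have h2 := j.2
            have h3 : (i : α) ≠ j := fun e => hij (Subtype.ext e)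
            ext x
            simp only [cyc, Finset.mem_filter]
            grind
          rw [this, pathNum_empty]
          simp [hij]
      rw [hmat, Matrix.det_neg, det_one_add_ones, Fintype.card_coe, hcard]
      norm_num
  | succ k ih =>
    intro S T h hT
    obtain ⟨S', T', E, a, b, h', hear, rfl, rfl⟩ := h.exists_ear hd (by
      rw [← Finset.card_pos]; omega)
    rw [Finset.card_insert_of_notMem hear.cell_notMem, Nat.add_right_cancel_iff] at hT
    obtain ⟨hcard, hside, hdet⟩ := ih S' T' h' hT
    have hcard' : (S' ∪ E).card = 2 + (k + 1) * (d - 2) := by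
      rw [Finset.card_union_of_disjoint hear.disjoint, hcard, hear.card]
      ring
    rw [← hT] at hcard
    refine ⟨hcard', fun u hu v hv huv hadj => hear.pathNum_side hcard hside hu hv huv hadj, ?_⟩
    rw [hear.det_pathMat hcard (hside a hear.left_mem b hear.right_mem hear.lt hear.adj), hdet,
      hcard', hcard, hT, show 2 + (k + 1) * (d - 2) - 1 = (2 + k * (d - 2) - 1) + (d - 2) by
        rw [add_mul]; omega, pow_add, pow_succ]
    ring

end IsDissection

end PathCounting

section Polygon

variable {n : ℕ} [NeZero n]

/-- The linear order on the vertices of the `n`-gon given by their canonical labels. -/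
abbrev ZMod.valLinearOrder (n : ℕ) [NeZero n] : LinearOrder (ZMod n) :=
  LinearOrder.lift' ZMod.val (ZMod.val_injective n)

attribute [local instance] ZMod.valLinearOrder

lemma val_sub_sub_one (x y : ZMod n) :
    (x - y - 1).val = if y.val < x.val then x.val - y.val - 1 else x.val + n - y.val - 1 := by
  have hx := ZMod.val_lt x
  have hy := ZMod.val_lt y
  have h : x - y - 1 = ((x.val + n - y.val - 1 : ℕ) : ZMod n) := by
    rw [Nat.cast_sub (by omega), Nat.cast_sub (by omega)]
    simp
  rw [h, ZMod.val_natCast]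
  split_ifs with hyx
  · rw [show x.val + n - y.val - 1 = x.val - y.val - 1 + n by omega, Nat.add_mod_right,
      Nat.mod_eq_of_lt (by omega)]
  · exact Nat.mod_eq_of_lt (by omega)

lemma mem_cyc_univ_iff (i j v : ZMod n) :
    v ∈ cyc Finset.univ i j ↔ ∃ k : Fin (pathLen n i j), i + 1 + ((k : ℕ) : ZMod n) = v := by
  have hlt : v ∈ cyc Finset.univ i j ↔ (v - i - 1).val < pathLen n i j := by
    have hlt' : ∀ x y : ZMod n, x < y ↔ x.val < y.val := fun _ _ => Iff.rfl
    have hi := ZMod.val_lt i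
    have hj := ZMod.val_lt j
    have hv := ZMod.val_lt v
    simp only [cyc, Finset.mem_filter, Finset.mem_univ, true_and, hlt', pathLen, val_sub_sub_one]
    split_ifs <;> omega
  rw [hlt]
  constructor
  · intro h
    refine ⟨⟨_, h⟩, ?_⟩
    rw [ZMod.natCast_zmod_val]
    ring
  · rintro ⟨k, rfl⟩
    have hk : (k : ℕ) < n := k.2.trans (ZMod.val_lt _)
    rw [show i + 1 + ((k : ℕ) : ZMod n) - i - 1 = ((k : ℕ) : ZMod n) by ring,
      ZMod.val_natCast_of_lt hk]
    exact k.2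

lemma pathVertex_injective (i j : ZMod n) :
    Function.Injective fun k : Fin (pathLen n i j) => i + 1 + ((k : ℕ) : ZMod n) := by
  intro k l hkl
  have h := congrArg ZMod.val (add_left_cancel hkl)
  rw [ZMod.val_natCast_of_lt (k.2.trans (ZMod.val_lt _)),
    ZMod.val_natCast_of_lt (l.2.trans (ZMod.val_lt _))] at h
  exact Fin.ext h

lemma dPathCount_eq_pathNum (d : ℕ) (T : Finset (Finset (ZMod n))) (i j : ZMod n) :
    dPathCount n d T i j = pathNum d T (cyc Finset.univ i j) := by
  set A := cyc Finset.univ i j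
  set e : Fin (pathLen n i j) → ZMod n := fun k => i + 1 + ((k : ℕ) : ZMod n) with he
  have hinj : Function.Injective e := pathVertex_injective i j
  have hmem : ∀ v, v ∈ A ↔ ∃ k, e k = v := mem_cyc_univ_iff i j
  have hcard : ∀ (f : ZMod n → Finset (ZMod n)) (c : Finset (ZMod n)),
      (A.filter fun v => f v = c).card = (Finset.univ.filter fun k => f (e k) = c).card := by
    intro f c
    symm
    refine Finset.card_bij (fun k _ => e k) ?_ (fun _ _ _ _ h => hinj h) ?_
    · intro k hk
      simp only [Finset.mem_filter, Finset.mem_univ, true_and] at hk ⊢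
      exact ⟨(hmem _).2 ⟨k, rfl⟩, hk⟩
    · intro v hv
      rw [Finset.mem_filter, hmem] at hv
      obtain ⟨⟨k, rfl⟩, hk⟩ := hv
      exact ⟨k, by simpa using hk, rfl⟩
  have hpath : ∀ f ∈ pathAssignments d T A, ∀ k, f (e k) ∈ T ∧ e k ∈ f (e k) := fun f hf k =>
    (mem_pathAssignments.1 hf).2.1 _ ((hmem _).2 ⟨k, rfl⟩)
  have hext : ∀ (q : Fin (pathLen n i j) → {c // c ∈ T}) k,
      Function.extend e (fun k => (q k : Finset (ZMod n))) (fun _ => ∅) (e k) = q k :=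
    fun q k => hinj.extend_apply _ _ k
  rw [dPathCount, pathNum, ← Fintype.card_coe, ← Nat.card_eq_fintype_card]
  refine Nat.card_congr
    { toFun := fun q => ⟨Function.extend e (fun k => (q.1 k : Finset (ZMod n))) fun _ => ∅, ?_⟩
      invFun := fun f => ⟨fun k => ⟨f.1 (e k), (hpath f.1 f.2 k).1⟩, ?_, ?_⟩
      left_inv := ?_
      right_inv := ?_ }
  · rw [mem_pathAssignments]
    refine ⟨fun v hv => ?_, fun v hv => ?_, fun c hc => ?_⟩
    · rw [Function.extend_apply']
      rwa [← hmem]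
    · obtain ⟨k, rfl⟩ := (hmem v).1 hv
      rw [hext]
      exact ⟨(q.1 k).2, q.2.1 k⟩
    · refine Eq.trans_le ?_ (q.2.2 c hc)
      convert hcard _ c using 5
      rw [hext]
  · exact fun k => (hpath f.1 f.2 k).2
  · intro c hc
    refine Eq.trans_le ?_ ((mem_pathAssignments.1 f.2).2.2 c hc)
    convert (hcard f.1 c).symm
  · intro q
    apply Subtype.ext
    funext k
    exact Subtype.ext (hext q.1 k)
  · intro f
    apply Subtype.ext
    funext v
    change Function.extend e (fun k => f.1 (e k)) (fun _ => ∅) v = f.1 v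
    by_cases hv : v ∈ A
    · obtain ⟨k, rfl⟩ := (hmem v).1 hv
      exact hinj.extend_apply _ _ k
    · rw [(mem_pathAssignments.1 f.2).1 v hv]
      exact Function.extend_apply' _ _ _ (by rwa [← hmem])

lemma IsDAngulation.isDissection {d : ℕ} {T : Finset (Finset (ZMod n))} (hT : IsDAngulation n d T)
    (hd : 3 ≤ d) (hn : 3 ≤ n) : IsDissection d Finset.univ T := by
  obtain ⟨hcard, hcover, hdisj⟩ := hT
  have hcross : ∀ c ∈ T, ∀ c' ∈ T, c ≠ c' → ∀ u ∈ c, ∀ v ∈ c, ∀ x ∈ c', ∀ y ∈ c',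
      u.val < x.val → x.val < v.val → v.val < y.val → False := by
    intro c hc c' hc' hne u hu v hv x hx y hy
    exact not_cross_of_interior_disjoint (hd.trans_eq (hcard c hc).symm)
      (hd.trans_eq (hcard c' hc').symm) (hdisj c hc c' hc' hne) hu hv hx hy
  refine ⟨hcard, fun c _ => Finset.subset_univ c, hcross, ?_, ?_⟩
  · intro c hc u hu v hv hbet w _ huw hwv
    refine exists_cell_on_chord hcover huw hwv fun c' hc' x hx hux hxv y hy => ?_
    have hne : c' ≠ c := fun e => hbet x (e ▸ hx) hux hxv
    constructor
    · by_contra! hyu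
      exact hcross c' hc' c hc hne y hy x hx u hu v hv hyu hux hxv
    · by_contra! hvy
      exact hcross c hc c' hc' hne.symm u hu v hv x hx y hy hux hxv hvy
  · have h0 : (0 : ZMod n).val = 0 := ZMod.val_zero
    have h1 : ((1 : ℕ) : ZMod n).val = 1 := ZMod.val_natCast_of_lt (by omega)
    have hlast : ((n - 1 : ℕ) : ZMod n).val = n - 1 := ZMod.val_natCast_of_lt (by omega)
    have hle : ∀ x : ZMod n, (0 : ZMod n).val ≤ x.val ∧ x.val ≤ ((n - 1 : ℕ) : ZMod n).val := by
      intro x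
      have := ZMod.val_lt x
      omega
    refine ⟨0, Finset.mem_univ _, ((n - 1 : ℕ) : ZMod n), Finset.mem_univ _, ?_,
      fun x _ => hle x, fun _ => ?_⟩
    · show (0 : ZMod n).val < ((n - 1 : ℕ) : ZMod n).val
      omega
    · obtain ⟨c, hc, hlo, hhi, -⟩ := exists_cell_on_chord hcover (u := 0)
        (v := ((n - 1 : ℕ) : ZMod n)) (w := ((1 : ℕ) : ZMod n)) (by omega) (by omega)
        fun _ _ _ _ _ _ y _ => hle y
      exact ⟨c, hc, hlo, hhi⟩

lemma det_dPathCount {d : ℕ} (hd : 3 ≤ d) (hn : 3 ≤ n) {T : Finset (Finset (ZMod n))}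
    (hT : IsDAngulation n d T) :
    n = 2 + T.card * (d - 2) ∧
    (Matrix.of fun i j : Fin n =>
        (dPathCount n d T ((i : ℕ) : ZMod n) ((j : ℕ) : ZMod n) : ℤ)).det
      = (-1) ^ (n - 1) * (d - 1) ^ T.card := by
  obtain ⟨hcard, -, hdet⟩ := IsDissection.card_pathNum_det hd T.card Finset.univ T
    (hT.isDissection hd hn) rfl
  rw [Finset.card_univ, ZMod.card] at hcard hdet
  refine ⟨hcard, ?_⟩
  let e : Fin n ≃ (Finset.univ : Finset (ZMod n)) :=
    { toFun := fun i => ⟨((i : ℕ) : ZMod n), Finset.mem_univ _⟩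
      invFun := fun x => ⟨x.1.val, ZMod.val_lt _⟩
      left_inv := fun i => Fin.ext (ZMod.val_natCast_of_lt i.2)
      right_inv := fun x => Subtype.ext (ZMod.natCast_zmod_val _) }
  have hmat : (Matrix.of fun i j : Fin n =>
      (dPathCount n d T ((i : ℕ) : ZMod n) ((j : ℕ) : ZMod n) : ℤ)) =
      (pathMat d Finset.univ T).submatrix e e := by
    ext i j
    exact congrArg Nat.cast (dPathCount_eq_pathNum d T _ _)
  rw [hmat, Matrix.det_submatrix_equiv_self, ← hdet]
  convert rfl

end Polygon

/-- Determinant of the matrix of `d`-path numbers of any `d`-angulation `T` of the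
convex `n`-gon, `n = d + m * (d - 2)`:  `det M_T = (-1)^(n-1) * (d-1)^(m+1)`,
independently of the particular `d`-angulation. -/
theorem det_dPathMatrix (d m n : ℕ) (hd : 3 ≤ d) (hn : n = d + m * (d - 2))
    (T : Finset (Finset (ZMod n))) (hT : IsDAngulation n d T) :
    (Matrix.of fun i j : Fin n =>
        (dPathCount n d T ((i : ℕ) : ZMod n) ((j : ℕ) : ZMod n) : ℤ)).det
      = (-1) ^ (n - 1) * (d - 1) ^ (m + 1) := by
  have hn3 : 3 ≤ n := by omega
  have : NeZero n := ⟨by omega⟩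
  obtain ⟨hcard, hdet⟩ := det_dPathCount hd hn3 hT
  have hm : T.card = m + 1 := by
    refine Nat.eq_of_mul_eq_mul_right (show 0 < d - 2 by omega) ?_
    rw [add_mul]
    omega
  rw [hdet, hm]
end
end

section
/- Let T be a triangulation of a convex n-gon and M_T = (m_{i,j}) its associated matrix of path numbers (the d = 3 case of d-path counts). Then det M_T = −(−2)^{n−2}. -/
noncomputable section

section

variable {N : ℕ}

open Finset Function

/-- Systems of distinct representatives: injective assignments to each vertex `v ∈ A` of a cell
of `T` incident to `v`, extended by `∅` outside `A`. -/
def incidentChoices (T : Finset (Finset (Fin N))) (A : Finset (Fin N)) :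
    Finset (Fin N → Finset (Fin N)) :=
  {q | (∀ v ∈ A, q v ∈ T ∧ v ∈ q v) ∧ (∀ v ∉ A, q v = ∅) ∧ Set.InjOn q A}

theorem mem_incidentChoices {T : Finset (Finset (Fin N))} {A : Finset (Fin N)}
    {q : Fin N → Finset (Fin N)} :
    q ∈ incidentChoices T A ↔
      (∀ v ∈ A, q v ∈ T ∧ v ∈ q v) ∧ (∀ v ∉ A, q v = ∅) ∧ Set.InjOn q A := by
  simp [incidentChoices]

theorem incidentChoices_insert {T : Finset (Finset (Fin N))} {t : Finset (Fin N)} (ht : t ∉ T)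
    (A : Finset (Fin N)) :
    incidentChoices (insert t T) A = incidentChoices T A ∪
      {x ∈ A | x ∈ t}.biUnion fun x => (incidentChoices T (A.erase x)).image (update · x t) := by
  ext q
  simp only [mem_union, mem_biUnion, mem_filter, mem_image, mem_incidentChoices]
  constructor
  · rintro ⟨h1, h2, h3⟩
    by_cases h : ∃ x ∈ A, q x = t
    · obtain ⟨x, hx, rfl⟩ := h
      refine Or.inr ⟨x, ⟨hx, (h1 x hx).2⟩, update q x ∅, ⟨?_, ?_, ?_⟩, by simp⟩
      · intro v hv
        have hne : v ≠ x := (mem_erase.1 hv).1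
        have hv' := (mem_erase.1 hv).2
        have : q v ≠ q x := fun e => hne (h3 hv' hx e)
        simpa [hne, this] using h1 v hv'
      · intro v hv
        by_cases e : v = x
        · simp [e]
        · simpa [e] using h2 v (by simpa [e] using hv)
      · intro v hv w hw e
        simp only [coe_erase, Set.mem_sdiff, mem_coe, Set.mem_singleton_iff] at hv hw
        rw [update_of_ne hv.2, update_of_ne hw.2] at e
        exact h3 hv.1 hw.1 e
    · push Not at h
      exact Or.inl ⟨fun v hv => ⟨(mem_insert.1 (h1 v hv).1).resolve_left (h v hv), (h1 v hv).2⟩,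
        h2, h3⟩
  · rintro (⟨h1, h2, h3⟩ | ⟨x, ⟨hx, hxt⟩, q, ⟨h1, h2, h3⟩, rfl⟩)
    · exact ⟨fun v hv => ⟨mem_insert_of_mem (h1 v hv).1, (h1 v hv).2⟩, h2, h3⟩
    · refine ⟨?_, ?_, ?_⟩
      · intro v hv
        by_cases e : v = x
        · subst e; simpa using hxt
        · have := h1 v (mem_erase.2 ⟨e, hv⟩)
          simp [e, this]
      · intro v hv
        have e : v ≠ x := fun e => hv (e ▸ hx)
        simpa [e] using h2 v (by simp [hv])
      · intro v hv w hw e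
        by_cases ev : v = x <;> by_cases ew : w = x
        · rw [ev, ew]
        · subst ev
          have := (h1 w (mem_erase.2 ⟨ew, hw⟩)).1
          rw [update_self, update_of_ne ew] at e
          exact absurd (e ▸ this) ht
        · subst ew
          have := (h1 v (mem_erase.2 ⟨ev, hv⟩)).1
          rw [update_self, update_of_ne ev] at e
          exact absurd (e ▸ this) ht
        · rw [update_of_ne ev, update_of_ne ew] at e
          exact h3 (by simpa [ev] using hv) (by simpa [ew] using hw) e

/-- The number of systems of distinct representatives of the vertices in `A` by cells of `T`. -/
def choiceCount (T : Finset (Finset (Fin N))) (A : Finset (Fin N)) : ℕ :=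
  (incidentChoices T A).card

theorem choiceCount_insert {T : Finset (Finset (Fin N))} {t : Finset (Fin N)} (ht : t ∉ T)
    (A : Finset (Fin N)) :
    choiceCount (insert t T) A =
      choiceCount T A + ∑ x ∈ A with x ∈ t, choiceCount T (A.erase x) := by
  unfold choiceCount
  have hval : ∀ {x} {q : Fin N → Finset (Fin N)} {A},
      q ∈ incidentChoices T A → x ∈ t → q x ≠ t := by
    rintro x q A hq hx rfl
    rw [mem_incidentChoices] at hq
    by_cases hxA : x ∈ A
    · exact ht (hq.1 x hxA).1
    · rw [hq.2.1 x hxA] at hx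
      exact notMem_empty _ hx
  rw [incidentChoices_insert ht, card_union_of_disjoint, card_biUnion]
  · congr 1
    refine sum_congr rfl fun x _ => card_image_of_injOn ?_
    intro q hq r hr e
    funext v
    by_cases ev : v = x
    · subst ev
      rw [(mem_incidentChoices.1 hq).2.1 v (by simp), (mem_incidentChoices.1 hr).2.1 v (by simp)]
    · simpa [ev] using congrFun e v
  · intro x hx y hy hxy
    rw [Function.onFun, disjoint_left]
    intro f hf hf'
    obtain ⟨q, hq, rfl⟩ := mem_image.1 hf
    obtain ⟨r, hr, e⟩ := mem_image.1 hf'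
    have := congrFun e y
    simp only [update_self, update_of_ne (Ne.symm hxy)] at this
    exact hval hq (mem_filter.1 hy).2 this.symm
  · rw [disjoint_left]
    intro f hf hf'
    obtain ⟨x, hx, hf'⟩ := mem_biUnion.1 hf'
    obtain ⟨r, hr, rfl⟩ := mem_image.1 hf'
    exact hval hf (mem_filter.1 hx).2 (by simp)

theorem choiceCount_empty (T : Finset (Finset (Fin N))) : choiceCount T ∅ = 1 := by
  rw [choiceCount, card_eq_one]
  refine ⟨fun _ => ∅, ?_⟩
  ext q
  simp [mem_incidentChoices, funext_iff]

theorem choiceCount_eq_zero_of_card_lt {T : Finset (Finset (Fin N))} {A : Finset (Fin N)}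
    (h : T.card < A.card) : choiceCount T A = 0 := by
  rw [choiceCount, card_eq_zero, eq_empty_iff_forall_notMem]
  intro q hq
  rw [mem_incidentChoices] at hq
  exact absurd (card_le_card_of_injOn q (fun v hv => (hq.1 v hv).1) hq.2.2) (by omega)

theorem choiceCount_eq_zero_of_notMem {T : Finset (Finset (Fin N))} {A : Finset (Fin N)}
    {b : Fin N} (hb : b ∈ A) (h : ∀ t ∈ T, b ∉ t) : choiceCount T A = 0 := by
  rw [choiceCount, card_eq_zero, eq_empty_iff_forall_notMem]
  intro q hq
  have := (mem_incidentChoices.1 hq).1 b hb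
  exact h _ this.1 this.2

/-- The vertices of `S` met strictly between `i` and `j` when going around in increasing cyclic
order; for `i = j` these are all vertices of `S` but `i`. -/
def cyclicIoo (S : Finset (Fin N)) (i j : Fin N) : Finset (Fin N) :=
  {s ∈ S | if i < j then i < s ∧ s < j else i < s ∨ s < j}

/-- Path numbers of a polygon with vertex set `S` and set of cells `T`. -/
def pathNumber (S : Finset (Fin N)) (T : Finset (Finset (Fin N))) (i j : Fin N) : ℕ :=
  choiceCount T (cyclicIoo S i j)

/-- A combinatorial triangulation of the polygon with vertex set `S`. -/
structure IsCombTriangulation (S : Finset (Fin N)) (T : Finset (Finset (Fin N))) : Prop where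
  subset : ∀ t ∈ T, t ⊆ S
  card_eq : ∀ t ∈ T, t.card = 3
  noncrossing : ∀ t ∈ T, ∀ t' ∈ T, ∀ x ∈ t, ∀ y ∈ t, ∀ z ∈ t', ∀ w ∈ t',
    x < z → z < y → y < w → False
  exists_cell : ∀ x ∈ S, ∀ y ∈ S, ((∀ s ∈ S, x ≤ s ∧ s ≤ y) ∨ ∃ t ∈ T, x ∈ t ∧ y ∈ t) →
    (∃ z ∈ S, x < z ∧ z < y) → ∃ z, x < z ∧ z < y ∧ {x, z, y} ∈ T

/-- `b` is an ear of the triangulation, with neighbours `a` and `c` in `S`. -/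
structure IsEar_s11 (S : Finset (Fin N)) (T : Finset (Finset (Fin N))) (a b c : Fin N) : Prop where
  lt_left : a < b
  lt_right : b < c
  mem_cells : {a, b, c} ∈ T
  left_mem : a ∈ S
  mem : b ∈ S
  right_mem : c ∈ S
  gap_left : ∀ s ∈ S, s ≤ a ∨ b ≤ s
  gap_right : ∀ s ∈ S, s ≤ b ∨ c ≤ s
  unique : ∀ t ∈ T, b ∈ t → t = {a, b, c}

theorem IsCombTriangulation.exists_isEar {S : Finset (Fin N)} {T : Finset (Finset (Fin N))}
    (h : IsCombTriangulation S T) (hS : 3 ≤ S.card) : ∃ a b c, IsEar_s11 S T a b c := by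
  have hne : S.Nonempty := card_pos.1 (by omega)
  obtain ⟨z, hz, hzmin, hzmax⟩ : ∃ z ∈ S, z ≠ S.min' hne ∧ z ≠ S.max' hne := by
    by_contra! hcon
    have hsub : S ⊆ {S.min' hne, S.max' hne} := by
      intro z hz
      by_cases e : z = S.min' hne
      · simp [← e]
      · simp [← hcon z hz e]
    have := (card_le_card hsub).trans card_le_two
    omega
  obtain ⟨w, hw1, hw2, hw3⟩ := h.exists_cell _ (S.min'_mem hne) _ (S.max'_mem hne)
    (Or.inl fun s hs => ⟨S.min'_le s hs, S.le_max' s hs⟩)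
    ⟨z, hz, lt_of_le_of_ne (S.min'_le z hz) hzmin.symm, lt_of_le_of_ne (S.le_max' z hz) hzmax⟩
  let P : Finset (Fin N × Fin N × Fin N) :=
    {p | p.1 < p.2.1 ∧ p.2.1 < p.2.2 ∧ {p.1, p.2.1, p.2.2} ∈ T}
  obtain ⟨⟨a, b, c⟩, hp, hmin⟩ := P.exists_min_image (fun p => (p.2.2 : ℕ) - p.1)
    ⟨(_, w, _), by simpa [P] using ⟨hw1, hw2, hw3⟩⟩
  simp only [P, mem_filter, mem_univ, true_and] at hp hmin
  obtain ⟨hab, hbc, ht⟩ := hp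
  have hsub := h.subset _ ht
  have haS : a ∈ S := hsub (by simp)
  have hbS : b ∈ S := hsub (by simp)
  have hcS : c ∈ S := hsub (by simp)
  have gl : ∀ s ∈ S, s ≤ a ∨ b ≤ s := by
    intro s hs
    by_contra! hcon
    obtain ⟨u, h1, h2, h3⟩ := h.exists_cell a haS b hbS (Or.inr ⟨_, ht, by simp, by simp⟩)
      ⟨s, hs, hcon⟩
    have := hmin (a, u, b) ⟨h1, h2, h3⟩
    simp only at this
    omega
  have gr : ∀ s ∈ S, s ≤ b ∨ c ≤ s := by
    intro s hs
    by_contra! hcon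
    obtain ⟨u, h1, h2, h3⟩ := h.exists_cell b hbS c hcS (Or.inr ⟨_, ht, by simp, by simp⟩)
      ⟨s, hs, hcon⟩
    have := hmin (b, u, c) ⟨h1, h2, h3⟩
    simp only at this
    omega
  refine ⟨a, b, c, hab, hbc, ht, haS, hbS, hcS, gl, gr, fun t htT hbt => ?_⟩
  refine eq_of_subset_of_card_le (fun x hx => ?_) ?_
  · by_contra hcon
    simp only [mem_insert, mem_singleton, not_or] at hcon
    have hxS := h.subset t htT hx
    have h1 := gl x hxS
    have h2 := gr x hxS
    rcases lt_or_gt_of_ne hcon.1 with h3 | h3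
    · exact h.noncrossing t htT _ ht x hx b hbt a (by simp) c (by simp) h3 hab hbc
    · exact h.noncrossing _ ht t htT a (by simp) c (by simp) b hbt x hx hab hbc (by omega)
  · rw [h.card_eq t htT, h.card_eq _ ht]

theorem IsCombTriangulation.erase {S : Finset (Fin N)} {T : Finset (Finset (Fin N))}
    (h : IsCombTriangulation S T) {a b c : Fin N} (e : IsEar_s11 S T a b c) :
    IsCombTriangulation (S.erase b) (T.erase {a, b, c}) where
  subset t ht x hx := by
    rw [mem_erase] at ht ⊢
    exact ⟨fun hxb => ht.1 (e.unique t ht.2 (hxb ▸ hx)), h.subset t ht.2 hx⟩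
  card_eq t ht := h.card_eq t (mem_of_mem_erase ht)
  noncrossing t ht t' ht' := h.noncrossing t (mem_of_mem_erase ht) t' (mem_of_mem_erase ht')
  exists_cell x hx y hy hxy hz := by
    obtain ⟨z, hz, hxz, hzy⟩ := hz
    have hac := e.lt_left
    have hbc := e.lt_right
    rw [mem_erase] at hx hy hz
    obtain ⟨u, h1, h2, h3⟩ := h.exists_cell x hx.2 y hy.2 (by
      rcases hxy with hxy | ⟨t, ht, hxy⟩
      · refine Or.inl fun s hs => ?_
        by_cases hsb : s = b
        · have h1 := hxy a (mem_erase.2 ⟨by omega, e.left_mem⟩)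
          have h2 := hxy c (mem_erase.2 ⟨by omega, e.right_mem⟩)
          omega
        · exact hxy s (mem_erase.2 ⟨hsb, hs⟩)
      · exact Or.inr ⟨t, mem_of_mem_erase ht, hxy⟩) ⟨z, hz.2, hxz, hzy⟩
    refine ⟨u, h1, h2, mem_erase.2 ⟨fun heq => ?_, h3⟩⟩
    have hx' : x ∈ ({a, b, c} : Finset (Fin N)) := heq ▸ by simp
    have hy' : y ∈ ({a, b, c} : Finset (Fin N)) := heq ▸ by simp
    have g1 := e.gap_left z hz.2
    have g2 := e.gap_right z hz.2
    simp only [mem_insert, mem_singleton] at hx' hy'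
    omega

section Ear

variable {S : Finset (Fin N)} {T : Finset (Finset (Fin N))} {a b c : Fin N}

theorem IsEar_s11.choiceCount_eq (e : IsEar_s11 S T a b c) (A : Finset (Fin N)) :
    choiceCount T A = choiceCount (T.erase {a, b, c}) A +
      ∑ x ∈ A with x ∈ ({a, b, c} : Finset (Fin N)),
        choiceCount (T.erase {a, b, c}) (A.erase x) := by
  conv_lhs => rw [← insert_erase e.mem_cells]
  exact choiceCount_insert (notMem_erase _ _) A

theorem IsEar_s11.notMem_of_mem_erase (e : IsEar_s11 S T a b c) :
    ∀ t ∈ T.erase {a, b, c}, b ∉ t :=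
  fun t ht hb => (mem_erase.1 ht).1 (e.unique t (mem_erase.1 ht).2 hb)

theorem IsEar_s11.choiceCount_of_mem (e : IsEar_s11 S T a b c) {A : Finset (Fin N)} (hb : b ∈ A) :
    choiceCount T A = choiceCount (T.erase {a, b, c}) (A.erase b) := by
  rw [e.choiceCount_eq, choiceCount_eq_zero_of_notMem hb e.notMem_of_mem_erase, zero_add]
  refine sum_eq_single_of_mem b (by simp [hb]) fun x _ hx => ?_
  exact choiceCount_eq_zero_of_notMem (mem_erase.2 ⟨hx.symm, hb⟩) e.notMem_of_mem_erase

theorem IsEar_s11.choiceCount_of_disjoint (e : IsEar_s11 S T a b c) {A : Finset (Fin N)}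
    (ha : a ∉ A) (hb : b ∉ A) (hc : c ∉ A) :
    choiceCount T A = choiceCount (T.erase {a, b, c}) A := by
  rw [e.choiceCount_eq, filter_false_of_mem, sum_empty, add_zero]
  rintro x hx
  simp only [mem_insert, mem_singleton]
  rintro (rfl | rfl | rfl) <;> contradiction

theorem IsEar_s11.choiceCount_of_left (e : IsEar_s11 S T a b c) {A : Finset (Fin N)}
    (ha : a ∈ A) (hb : b ∉ A) (hc : c ∉ A) :
    choiceCount T A = choiceCount (T.erase {a, b, c}) A +
      choiceCount (T.erase {a, b, c}) (A.erase a) := by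
  rw [e.choiceCount_eq, show ({x ∈ A | x ∈ ({a, b, c} : Finset (Fin N))}) = {a} by
    ext x; simp only [mem_filter, mem_insert, mem_singleton]; grind, sum_singleton]

theorem IsEar_s11.choiceCount_of_right (e : IsEar_s11 S T a b c) {A : Finset (Fin N)}
    (ha : a ∉ A) (hb : b ∉ A) (hc : c ∈ A) :
    choiceCount T A = choiceCount (T.erase {a, b, c}) A +
      choiceCount (T.erase {a, b, c}) (A.erase c) := by
  rw [e.choiceCount_eq, show ({x ∈ A | x ∈ ({a, b, c} : Finset (Fin N))}) = {c} by
    ext x; simp only [mem_filter, mem_insert, mem_singleton]; grind, sum_singleton]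

theorem mem_cyclicIoo {i j s : Fin N} :
    s ∈ cyclicIoo S i j ↔ s ∈ S ∧ if i < j then i < s ∧ s < j else i < s ∨ s < j := by
  simp [cyclicIoo]

theorem cyclicIoo_self (i : Fin N) : cyclicIoo S i i = S.erase i := by
  ext s
  rw [mem_cyclicIoo, mem_erase]
  grind

theorem pathNumber_self (hcard : T.card + 2 = S.card) {i : Fin N} (hi : i ∈ S) :
    pathNumber S T i i = 0 := by
  rw [pathNumber, cyclicIoo_self]
  apply choiceCount_eq_zero_of_card_lt
  rw [card_erase_of_mem hi]
  omega

theorem IsEar_s11.pathNumber_of_ne (e : IsEar_s11 S T a b c) {i j : Fin N} (hi : i ∈ S) (hj : j ∈ S)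
    (hib : i ≠ b) (hjb : j ≠ b) :
    pathNumber S T i j = pathNumber (S.erase b) (T.erase {a, b, c}) i j := by
  obtain ⟨hab, hbc, -, ha, hb, hc, gl, gr, -⟩ := id e
  have hi1 := gl i hi
  have hi2 := gr i hi
  have hj1 := gl j hj
  have hj2 := gr j hj
  have hA : cyclicIoo (S.erase b) i j = (cyclicIoo S i j).erase b := by
    ext s; simp only [mem_cyclicIoo, mem_erase]; tauto
  rw [pathNumber, pathNumber, hA]
  by_cases hbA : b ∈ cyclicIoo S i j
  · exact e.choiceCount_of_mem hbA
  · rw [erase_eq_of_notMem hbA]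
    rw [mem_cyclicIoo] at hbA
    refine e.choiceCount_of_disjoint ?_ (by rwa [mem_cyclicIoo]) ?_ <;> rw [mem_cyclicIoo] <;>
      grind

theorem IsEar_s11.pathNumber_row (e : IsEar_s11 S T a b c) (hcard : T.card + 2 = S.card)
    {j : Fin N} (hj : j ∈ S) (hjb : j ≠ b) :
    pathNumber S T b j = pathNumber S T a j + pathNumber S T c j := by
  obtain ⟨hab, hbc, -, ha, hb, hc, gl, gr, -⟩ := id e
  have hj1 := gl j hj
  have hj2 := gr j hj
  by_cases hjc : j = c
  · subst hjc
    rw [pathNumber_self hcard hj, e.pathNumber_of_ne ha hj hab.ne hjb, pathNumber, pathNumber,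
      show cyclicIoo S b j = ∅ by
        ext s; simp only [mem_cyclicIoo, notMem_empty, iff_false]; grind,
      show cyclicIoo (S.erase b) a j = ∅ by
        ext s; simp only [mem_cyclicIoo, notMem_empty, iff_false, mem_erase]; grind,
      choiceCount_empty, choiceCount_empty]
  · rw [e.pathNumber_of_ne ha hj hab.ne hjb, e.pathNumber_of_ne hc hj hbc.ne' hjb,
      pathNumber, pathNumber, pathNumber, e.choiceCount_of_right]
    · congr 2 <;> ext s <;> simp only [mem_cyclicIoo, mem_erase] <;> grind
    all_goals rw [mem_cyclicIoo]; grind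

theorem IsEar_s11.pathNumber_col (e : IsEar_s11 S T a b c) (hcard : T.card + 2 = S.card)
    {i : Fin N} (hi : i ∈ S) (hib : i ≠ b) :
    pathNumber S T i b = pathNumber S T i a + pathNumber S T i c := by
  obtain ⟨hab, hbc, -, ha, hb, hc, gl, gr, -⟩ := id e
  have hi1 := gl i hi
  have hi2 := gr i hi
  by_cases hia : i = a
  · subst hia
    rw [pathNumber_self hcard hi, e.pathNumber_of_ne hi hc hib hbc.ne', pathNumber, pathNumber,
      show cyclicIoo S i b = ∅ by
        ext s; simp only [mem_cyclicIoo, notMem_empty, iff_false]; grind,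
      show cyclicIoo (S.erase b) i c = ∅ by
        ext s; simp only [mem_cyclicIoo, notMem_empty, iff_false, mem_erase]; grind,
      choiceCount_empty, choiceCount_empty]
  · rw [e.pathNumber_of_ne hi ha hib hab.ne, e.pathNumber_of_ne hi hc hib hbc.ne',
      pathNumber, pathNumber, pathNumber, e.choiceCount_of_left, add_comm]
    · congr 2 <;> ext s <;> simp only [mem_cyclicIoo, mem_erase] <;> grind
    all_goals rw [mem_cyclicIoo]; grind

end Ear

theorem IsCombTriangulation.eq_empty_of_card_eq_two {S : Finset (Fin N)}
    {T : Finset (Finset (Fin N))} (h : IsCombTriangulation S T) (hS : S.card = 2) : T = ∅ := by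
  refine eq_empty_of_forall_notMem fun t ht => ?_
  have := card_le_card (h.subset t ht)
  rw [h.card_eq t ht] at this
  omega

theorem IsCombTriangulation.card_add_two {S : Finset (Fin N)} {T : Finset (Finset (Fin N))}
    (h : IsCombTriangulation S T) (hS : 2 ≤ S.card) : T.card + 2 = S.card := by
  induction hk : S.card generalizing S T with
  | zero => omega
  | succ k ih =>
    rcases hS.eq_or_lt with h2 | h3
    · rw [h.eq_empty_of_card_eq_two h2.symm, card_empty]; omega
    · obtain ⟨a, b, c, e⟩ := h.exists_isEar h3
      have hk' : (S.erase b).card = k := by rw [card_erase_of_mem e.mem]; omega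
      have := ih (h.erase e) (by omega) hk'
      have := card_erase_add_one e.mem_cells
      omega

theorem IsCombTriangulation.pathNumber_comm {S : Finset (Fin N)} {T : Finset (Finset (Fin N))}
    (h : IsCombTriangulation S T) (hS : 2 ≤ S.card) {i j : Fin N} (hi : i ∈ S) (hj : j ∈ S) :
    pathNumber S T i j = pathNumber S T j i := by
  induction hk : S.card generalizing S T i j with
  | zero => omega
  | succ k ih =>
    rcases hS.eq_or_lt with h2 | h3
    · rcases eq_or_ne i j with rfl | hij
      · rfl
      have hSij : S = {i, j} := by
        refine (eq_of_subset_of_card_le ?_ ?_).symm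
        · simp [insert_subset_iff, hi, hj]
        · rw [card_pair hij, h2]
      have : ∀ x y : Fin N, x ≠ y → cyclicIoo {x, y} x y = ∅ := by
        intro x y hxy
        ext s; simp only [mem_cyclicIoo, notMem_empty, iff_false, mem_insert, mem_singleton]; grind
      rw [pathNumber, pathNumber, hSij, this i j hij, pair_comm, this j i hij.symm]
    · obtain ⟨a, b, c, e⟩ := h.exists_isEar h3
      have hcard := h.card_add_two hS
      have hk' : (S.erase b).card = k := by rw [card_erase_of_mem e.mem]; omega
      have key : ∀ {i j}, i ∈ S → j ∈ S → i ≠ b → j ≠ b →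
          pathNumber S T i j = pathNumber S T j i := by
        intro i j hi hj hib hjb
        rw [e.pathNumber_of_ne hi hj hib hjb, e.pathNumber_of_ne hj hi hjb hib]
        exact ih (h.erase e) (by omega) (mem_erase.2 ⟨hib, hi⟩) (mem_erase.2 ⟨hjb, hj⟩) hk'
      by_cases hib : i = b <;> by_cases hjb : j = b
      · rw [hib, hjb]
      · rw [hib, e.pathNumber_row hcard hj hjb, e.pathNumber_col hcard hj hjb,
          key e.left_mem hj e.lt_left.ne hjb, key e.right_mem hj e.lt_right.ne' hjb]
      · rw [hjb, e.pathNumber_row hcard hi hib, e.pathNumber_col hcard hi hib,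
          key e.left_mem hi e.lt_left.ne hib, key e.right_mem hi e.lt_right.ne' hib]
      · exact key hi hj hib hjb

/-- The matrix of path numbers on `S`, extended by the identity matrix outside `S`. -/
def pathMatrix (S : Finset (Fin N)) (T : Finset (Finset (Fin N))) : Matrix (Fin N) (Fin N) ℤ :=
  Matrix.of fun i j => if i ∈ S ∧ j ∈ S then (pathNumber S T i j : ℤ) else if i = j then 1 else 0

theorem pathMatrix_apply (S : Finset (Fin N)) (T : Finset (Finset (Fin N))) (i j : Fin N) :
    pathMatrix S T i j =
      if i ∈ S ∧ j ∈ S then (pathNumber S T i j : ℤ) else if i = j then 1 else 0 := rfl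

theorem pathMatrix_univ_apply (T : Finset (Finset (Fin N))) (i j : Fin N) :
    pathMatrix univ T i j = pathNumber univ T i j := by
  simp [pathMatrix_apply]

theorem IsEar_s11.det_pathMatrix {S : Finset (Fin N)} {T : Finset (Finset (Fin N))} {a b c : Fin N}
    (e : IsEar_s11 S T a b c) (h : IsCombTriangulation S T) (hS : 2 ≤ S.card) :
    (pathMatrix S T).det = -2 * (pathMatrix (S.erase b) (T.erase {a, b, c})).det := by
  have hcard := h.card_add_two hS
  set M := pathMatrix S T with hM
  have hadj : ∀ {x y : Fin N}, (∀ s ∈ S, s ≤ x ∨ y ≤ s) → x < y → pathNumber S T x y = 1 := by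
    intro x y hgap hxy
    rw [pathNumber, show cyclicIoo S x y = ∅ by
      ext s; simp only [mem_cyclicIoo, notMem_empty, iff_false]; grind, choiceCount_empty]
  have hrow : M b = M a + M c + (-2 : ℤ) • Pi.single b 1 := by
    funext j
    simp only [hM, Pi.add_apply, Pi.smul_apply, pathMatrix_apply, e.mem, e.left_mem, e.right_mem,
      true_and, smul_eq_mul]
    by_cases hjb : j = b
    · subst hjb
      rw [if_pos e.mem, if_pos e.mem, if_pos e.mem, pathNumber_self hcard e.mem,
        hadj e.gap_left e.lt_left, h.pathNumber_comm hS e.right_mem e.mem,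
        hadj e.gap_right e.lt_right]
      simp
    · rw [Pi.single_eq_of_ne hjb]
      by_cases hj : j ∈ S
      · simp only [if_pos hj, e.pathNumber_row hcard hj hjb]
        push_cast; ring
      · have h1 : b ≠ j := fun h => hj (h ▸ e.mem)
        have h2 : a ≠ j := fun h => hj (h ▸ e.left_mem)
        have h3 : c ≠ j := fun h => hj (h ▸ e.right_mem)
        simp [hj, h1, h2, h3]
  have hdet : M.det = -2 * (M.updateRow b (Pi.single b 1)).det := by
    conv_lhs => rw [← M.updateRow_eq_self b, hrow]
    rw [Matrix.det_updateRow_add, Matrix.det_updateRow_add, Matrix.det_updateRow_smul,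
      Matrix.det_updateRow_eq_zero e.lt_left.ne, Matrix.det_updateRow_eq_zero e.lt_right.ne']
    ring
  rw [hdet]
  congr 1
  refine Matrix.det_eq_of_forall_row_eq_smul_add_const (fun i => if i = b then 0 else M i b) b
    (by simp) fun i j => ?_
  by_cases hib : i = b
  · subst hib
    simp [pathMatrix_apply, Pi.single_apply, eq_comm]
  · rw [Matrix.updateRow_ne hib]
    by_cases hjb : j = b
    · subst hjb
      simp [pathMatrix_apply, hib]
    · by_cases hi : i ∈ S <;> by_cases hj : j ∈ S <;>
        simp [hM, pathMatrix_apply, hib, hjb, hi, hj, Ne.symm hjb]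
      exact e.pathNumber_of_ne hi hj hib hjb

theorem IsCombTriangulation.det_pathMatrix {S : Finset (Fin N)} {T : Finset (Finset (Fin N))}
    (h : IsCombTriangulation S T) (hS : 2 ≤ S.card) :
    (pathMatrix S T).det = -(-2) ^ (S.card - 2) := by
  induction hk : S.card generalizing S T with
  | zero => omega
  | succ k ih =>
    rcases hS.eq_or_lt with h2 | h3
    · obtain ⟨x, y, hxy, rfl⟩ := card_eq_two.1 h2.symm
      have hcard := h.card_add_two hS
      have hadj : ∀ i ∈ ({x, y} : Finset (Fin N)), ∀ j ∈ ({x, y} : Finset (Fin N)), i ≠ j →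
          pathNumber {x, y} T i j = 1 := by
        intro i hi j hj hij
        rw [pathNumber, show cyclicIoo {x, y} i j = ∅ by
          ext s
          simp only [mem_cyclicIoo, notMem_empty, iff_false, mem_insert, mem_singleton] at *
          grind, choiceCount_empty]
      have : pathMatrix {x, y} T = (Equiv.swap x y).permMatrix ℤ := by
        ext i j
        have hx : x ∈ ({x, y} : Finset (Fin N)) := by simp
        have hy : y ∈ ({x, y} : Finset (Fin N)) := by simp
        rw [pathMatrix_apply, Equiv.Perm.permMatrix, PEquiv.toMatrix_toPEquiv_apply,
          Pi.single_apply, Equiv.swap_apply_def]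
        have h1 := pathNumber_self hcard hx
        have h2 := pathNumber_self hcard hy
        have h3 := hadj x hx y hy hxy
        have h4 := hadj y hy x hx hxy.symm
        simp only [mem_insert, mem_singleton]
        grind
      rw [this, Matrix.det_permutation, Equiv.Perm.sign_swap hxy]
      have : k + 1 - 2 = 0 := by omega
      simp [this]
    · obtain ⟨a, b, c, e⟩ := h.exists_isEar h3
      have hk' : (S.erase b).card = k := by rw [card_erase_of_mem e.mem]; omega
      rw [e.det_pathMatrix h hS, ih (h.erase e) (by omega) hk', show k + 1 - 2 = (k - 2) + 1 by omega,
        pow_succ]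
      ring

/-- Twice the signed area of the triangle `P Q R`. -/
def cross (P Q R : ℝ × ℝ) : ℝ := (Q.1 - P.1) * (R.2 - P.2) - (Q.2 - P.2) * (R.1 - P.1)

theorem cross_rotate (P Q R : ℝ × ℝ) : cross Q R P = cross P Q R := by
  unfold cross; ring

theorem cross_swap (P Q R : ℝ × ℝ) : cross P R Q = -cross P Q R := by
  unfold cross; ring

theorem cross_left (P Q : ℝ × ℝ) : cross P Q P = 0 := by
  unfold cross; ring

theorem cross_right (P Q : ℝ × ℝ) : cross P Q Q = 0 := by
  unfold cross; ring

theorem cross_combo (P Q A B : ℝ × ℝ) {s t : ℝ} (h : s + t = 1) :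
    cross P Q (s • A + t • B) = s * cross P Q A + t * cross P Q B := by
  obtain rfl : s = 1 - t := by linarith
  simp [cross]; ring

theorem continuous_cross (P Q : ℝ × ℝ) : Continuous (cross P Q) := by
  unfold cross; fun_prop

theorem mem_convexHull_triangle {P Q R A : ℝ × ℝ} (h1 : 0 < cross P Q R * cross P Q A)
    (h2 : 0 < cross P Q R * cross Q R A) (h3 : 0 < cross P Q R * cross R P A) :
    A ∈ convexHull ℝ {P, Q, R} := by
  have hne : cross P Q R ≠ 0 := fun h => by simp [h] at h1
  have div_nonneg' : ∀ {u : ℝ}, 0 < cross P Q R * u → 0 ≤ u / cross P Q R := by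
    intro u hu
    rw [div_eq_mul_inv]
    rcases lt_or_gt_of_ne hne with h | h
    · exact (mul_pos_of_neg_of_neg (by nlinarith) (inv_lt_zero.2 h)).le
    · exact (mul_pos (by nlinarith) (inv_pos.2 h)).le
  refine mem_convexHull_of_exists_fintype (ι := Fin 3)
    ![cross Q R A / cross P Q R, cross R P A / cross P Q R, cross P Q A / cross P Q R]
    ![P, Q, R] ?_ ?_ ?_ ?_
  · intro i
    fin_cases i <;> simp [*]
  · simp only [Fin.sum_univ_three, Matrix.cons_val]
    field_simp
    unfold cross; ring
  · intro i
    fin_cases i <;> simp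
  · simp only [Fin.sum_univ_three, Matrix.cons_val]
    ext <;> simp <;> field_simp <;> unfold cross <;> ring

theorem mem_interior_triangle {P Q R A : ℝ × ℝ} (h1 : 0 < cross P Q R * cross P Q A)
    (h2 : 0 < cross P Q R * cross Q R A) (h3 : 0 < cross P Q R * cross R P A) :
    A ∈ interior (convexHull ℝ {P, Q, R}) := by
  have hopen : ∀ U V : ℝ × ℝ, IsOpen {B | 0 < cross P Q R * cross U V B} := fun U V =>
    isOpen_lt continuous_const (continuous_const.mul (continuous_cross U V))
  refine interior_maximal (s := convexHull ℝ {P, Q, R})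
    (t := {B | 0 < cross P Q R * cross P Q B} ∩ {B | 0 < cross P Q R * cross Q R B} ∩
      {B | 0 < cross P Q R * cross R P B})
    (fun B hB => mem_convexHull_triangle hB.1.1 hB.1.2 hB.2)
    (((hopen _ _).inter (hopen _ _)).inter (hopen _ _)) ⟨⟨h1, h2⟩, h3⟩

theorem interior_triangle_nonempty {P Q R : ℝ × ℝ} (h : cross P Q R ≠ 0) :
    (interior (convexHull ℝ {P, Q, R})).Nonempty := by
  have hpos := mul_self_pos.2 h
  set A : ℝ × ℝ := (3⁻¹ : ℝ) • (P + Q + R) with hA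
  have e1 : cross P Q A = cross P Q R / 3 := by simp [hA, cross]; ring
  have e2 : cross Q R A = cross P Q R / 3 := by simp [hA, cross]; ring
  have e3 : cross R P A = cross P Q R / 3 := by simp [hA, cross]; ring
  exact ⟨A, mem_interior_triangle (by rw [e1]; linarith) (by rw [e2]; linarith)
    (by rw [e3]; linarith)⟩

theorem exists_mem_segment_interior_triangle {X Y Z W Q : ℝ × ℝ} (h1 : 0 < cross X Z Y)
    (h2 : 0 < cross X Z W) (h3 : 0 < cross X Y W) (h4 : 0 < cross Z Y W)
    (hQ : cross Z W Q ≠ 0) :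
    ∃ R ∈ segment ℝ X Y, R ∈ interior (convexHull ℝ {Z, W, Q}) := by
  -- `O` is the crossing point of the segments `X Y` and `Z W`
  set σ := cross Z Y W + cross X Z W with hσ
  have hσpos : 0 < σ := by positivity
  set O : ℝ × ℝ := (cross Z Y W / σ) • X + (cross X Z W / σ) • Y with hO
  have hOs : O ∈ segment ℝ X Y :=
    ⟨_, _, by positivity, by positivity, by rw [← add_div, ← hσ, div_self hσpos.ne'], rfl⟩
  have hσ' : σ = cross X Y W + cross X Z Y := by simp only [hσ, cross]; ring
  have hO' : O = (cross X Y W / σ) • Z + (cross X Z Y / σ) • W := by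
    rw [hO]
    ext <;> simp only [Prod.fst_add, Prod.smul_fst, Prod.snd_add, Prod.smul_snd, smul_eq_mul] <;>
      field_simp <;> unfold cross <;> ring
  have hsum : cross X Y W / σ + cross X Z Y / σ = 1 := by
    rw [← add_div, ← hσ', div_self hσpos.ne']
  have hO1 : cross Z W O = 0 := by
    rw [hO', cross_combo _ _ _ _ hsum, cross_left, cross_right]; ring
  have hO2 : 0 < cross Z W Q * cross W Q O := by
    rw [hO', cross_combo _ _ _ _ hsum, cross_left, cross_rotate Z W Q]
    have := mul_self_pos.2 hQ
    have : 0 < cross X Y W / σ * (cross Z W Q * cross Z W Q) := by positivity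
    linarith
  have hO3 : 0 < cross Z W Q * cross Q Z O := by
    rw [hO', cross_combo _ _ _ _ hsum, cross_right, ← cross_rotate Q Z W]
    have := mul_self_pos.2 hQ
    have : 0 < cross X Z Y / σ * (cross Z W Q * cross Z W Q) := by positivity
    linarith
  obtain ⟨V, hV, hVQ⟩ : ∃ V ∈ segment ℝ X Y, 0 < cross Z W Q * cross Z W V := by
    rcases lt_or_gt_of_ne hQ with h | h
    · refine ⟨Y, right_mem_segment ℝ X Y, mul_pos_of_neg_of_neg h ?_⟩
      rw [cross_swap]; linarith
    · refine ⟨X, left_mem_segment ℝ X Y, mul_pos h ?_⟩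
      rwa [cross_rotate]
  have hcont : ∀ U U' : ℝ × ℝ, 0 < cross Z W Q * cross U U' O →
      ∀ᶠ ε : ℝ in nhdsWithin 0 (Set.Ioi 0), 0 < cross Z W Q * cross U U' ((1 - ε) • O + ε • V) := by
    intro U U' h
    have hc : Continuous fun ε : ℝ => cross Z W Q * cross U U' ((1 - ε) • O + ε • V) :=
      continuous_const.mul ((continuous_cross U U').comp (by fun_prop))
    refine nhdsWithin_le_nhds (hc.continuousAt.eventually (lt_mem_nhds ?_))
    simpa using h
  obtain ⟨ε, ⟨e2, e3⟩, e0, e1⟩ := (((hcont _ _ hO2).and (hcont _ _ hO3)).and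
    (Ioo_mem_nhdsGT (zero_lt_one (α := ℝ)))).exists
  refine ⟨(1 - ε) • O + ε • V, convex_segment X Y hOs hV (by linarith) e0.le (by ring),
    mem_interior_triangle ?_ e2 e3⟩
  rw [cross_combo _ _ _ _ (by ring), hO1]
  nlinarith

theorem convex_halfPlane_union_singleton {X Y V : ℝ × ℝ} (hV : cross X Y V = 0) :
    Convex ℝ {P | cross X Y P < 0 ∨ P = V} := by
  intro P hP Q hQ s t hs ht hst
  rcases hs.eq_or_lt with rfl | hs
  · obtain rfl : t = 1 := by linarith
    simpa using hQ
  rcases ht.eq_or_lt with rfl | ht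
  · obtain rfl : s = 1 := by linarith
    simpa using hP
  simp only [Set.mem_ofPred_eq] at *
  rw [cross_combo _ _ _ _ hst]
  rcases hP with hP | rfl <;> rcases hQ with hQ | rfl
  · exact Or.inl (by nlinarith)
  · rw [hV]; exact Or.inl (by nlinarith)
  · rw [hV]; exact Or.inl (by nlinarith)
  · exact Or.inr (by rw [← add_smul, hst, one_smul])

theorem convex_halfPlane (X Y : ℝ × ℝ) : Convex ℝ {P | 0 ≤ cross X Y P} := by
  intro P hP Q hQ s t hs ht hst
  simp only [Set.mem_ofPred_eq] at *
  rw [cross_combo _ _ _ _ hst]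
  positivity

section ConvexPosition

variable {p : Fin N → ℝ × ℝ}

theorem cross_ne_zero_of_convexPosition
    (hp : ∀ i j k, i < j → j < k → 0 < cross (p i) (p j) (p k))
    {i j k : Fin N} (hij : i ≠ j) (hjk : j ≠ k) (hik : i ≠ k) :
    cross (p i) (p j) (p k) ≠ 0 := by
  have a1 := cross_rotate (p i) (p j) (p k)
  have a2 := cross_rotate (p j) (p k) (p i)
  have b0 := cross_swap (p i) (p j) (p k)
  have b1 := cross_rotate (p i) (p k) (p j)
  have b2 := cross_rotate (p k) (p j) (p i)
  rcases lt_or_gt_of_ne hij with h1 | h1 <;> rcases lt_or_gt_of_ne hjk with h2 | h2 <;>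
    rcases lt_or_gt_of_ne hik with h3 | h3
  · linarith [hp i j k h1 h2]
  · omega
  · linarith [hp i k j h3 h2]
  · linarith [hp k i j h3 h1]
  · linarith [hp j i k h1 h3]
  · linarith [hp j k i h2 h3]
  · omega
  · linarith [hp k j i h2 h1]

theorem interiors_inter_nonempty
    (hp : ∀ i j k, i < j → j < k → 0 < cross (p i) (p j) (p k))
    {t t' : Finset (Fin N)} (ht : t.card = 3) (ht' : t'.card = 3)
    {x y z w : Fin N} (hx : x ∈ t) (hy : y ∈ t) (hz : z ∈ t') (hw : w ∈ t')
    (hxz : x < z) (hzy : z < y) (hyw : y < w) :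
    (interior (convexHull ℝ (p '' t)) ∩ interior (convexHull ℝ (p '' t'))).Nonempty := by
  have third : ∀ {s : Finset (Fin N)} {u v}, s.card = 3 → u ∈ s → v ∈ s → u ≠ v →
      ∃ q, q ≠ u ∧ q ≠ v ∧ s = {u, v, q} := by
    intro s u v hs hu hv huv
    obtain ⟨q, hq⟩ : ∃ q, q ∈ (s.erase u).erase v := by
      apply card_pos.1
      rw [card_erase_of_mem (by simp [hv, huv.symm]), card_erase_of_mem hu]; omega
    simp only [mem_erase] at hq
    refine ⟨q, hq.2.1, hq.1, (eq_of_subset_of_card_le ?_ ?_).symm⟩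
    · simp [insert_subset_iff, hu, hv, hq.2.2]
    · rw [hs, card_eq_three.2 ⟨u, v, q, huv, hq.2.1.symm, hq.1.symm, rfl⟩]
  obtain ⟨r, hrx, hry, rfl⟩ := third ht hx hy (hxz.trans hzy).ne
  obtain ⟨q, hqz, hqw, rfl⟩ := third ht' hz hw (hzy.trans hyw).ne
  simp only [coe_insert, coe_singleton, Set.image_insert_eq, Set.image_singleton]
  obtain ⟨R, hR, hR'⟩ := exists_mem_segment_interior_triangle (hp x z y hxz hzy)
    (hp x z w hxz (hzy.trans hyw)) (hp x y w (hxz.trans hzy) hyw) (hp z y w hzy hyw)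
    (cross_ne_zero_of_convexPosition hp (hzy.trans hyw).ne hqw.symm hqz.symm)
  have hRt : R ∈ closure (interior (convexHull ℝ {p x, p y, p r})) := by
    rw [(convex_convexHull ℝ _).closure_interior_eq_closure_of_nonempty_interior
      (interior_triangle_nonempty
        (cross_ne_zero_of_convexPosition hp (hxz.trans hzy).ne hry.symm hrx.symm))]
    refine subset_closure (segment_subset_convexHull (by simp) (by simp) hR)
  rw [Set.inter_comm]
  exact mem_closure_iff.1 hRt _ isOpen_interior hR'

theorem isCombTriangulation_of_cover
    (hp : ∀ i j k, i < j → j < k → 0 < cross (p i) (p j) (p k))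
    {T : Finset (Finset (Fin N))} (hcard : ∀ t ∈ T, t.card = 3)
    (hcover : ⋃ t ∈ T, convexHull ℝ (p '' (t : Set (Fin N))) = convexHull ℝ (Set.range p))
    (hdisj : ∀ t ∈ T, ∀ t' ∈ T, t ≠ t' →
      interior (convexHull ℝ (p '' (t : Set (Fin N)))) ∩
        interior (convexHull ℝ (p '' (t' : Set (Fin N)))) = ∅) :
    IsCombTriangulation univ T := by
  have hN : ∀ t ∈ T, ∀ t' ∈ T, ∀ x ∈ t, ∀ y ∈ t, ∀ z ∈ t', ∀ w ∈ t',
      x < z → z < y → y < w → False := by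
    intro t ht t' ht' x hx y hy z hz w hw hxz hzy hyw
    have hne : t ≠ t' := by
      rintro rfl
      have hsub : ({x, z, y, w} : Finset (Fin N)) ⊆ t := by simp [insert_subset_iff, *]
      have hle := card_le_card hsub
      have : ({x, z, y, w} : Finset (Fin N)).card = 4 := by
        rw [card_insert_of_notMem, card_eq_three.2 ⟨z, y, w, by omega, by omega, by omega, rfl⟩]
        simp only [mem_insert, mem_singleton]; omega
      have := hcard t ht
      omega
    have := interiors_inter_nonempty hp (hcard t ht) (hcard t' ht') hx hy hz hw hxz hzy hyw
    rw [hdisj t ht t' ht' hne] at this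
    exact Set.not_nonempty_empty this
  refine ⟨fun _ _ => subset_univ _, hcard, hN, ?_⟩
  rintro x - y - hxy ⟨z, -, hxz, hzy⟩
  by_contra! hcon
  set O : ℝ × ℝ := (2⁻¹ : ℝ) • p x + (2⁻¹ : ℝ) • p y with hO
  have hneg : ∀ u, x < u → u < y → cross (p x) (p y) (p u) < 0 := by
    intro u h1 h2
    rw [cross_swap]; linarith [hp x u y h1 h2]
  have hO0 : cross (p x) (p y) O = 0 := by
    rw [hO, cross_combo _ _ _ _ (by norm_num), cross_left, cross_right]; ring
  have hpxy : p x ≠ p y := fun h => by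
    have := hneg z hxz hzy
    simp [h, cross] at this
  have hcell : ∀ c ∈ T, ∀ᶠ ε : ℝ in nhdsWithin 0 (Set.Ioi 0),
      (1 - ε) • O + ε • p z ∉ convexHull ℝ (p '' (c : Set (Fin N))) := by
    intro c hc
    by_contra hfreq
    rw [Filter.not_eventually] at hfreq
    simp only [not_not] at hfreq
    have hOc : O ∈ convexHull ℝ (p '' (c : Set (Fin N))) := by
      have hclosed : IsClosed (convexHull ℝ (p '' (c : Set (Fin N)))) :=
        ((c.finite_toSet.image p).isCompact_convexHull (𝕜 := ℝ)).isClosed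
      have hcont : Continuous fun ε : ℝ => (1 - ε) • O + ε • p z := by fun_prop
      have htend : Filter.Tendsto (fun ε : ℝ => (1 - ε) • O + ε • p z)
          (nhdsWithin 0 (Set.Ioi 0)) (nhds O) := by
        simpa using (hcont.tendsto 0).mono_left nhdsWithin_le_nhds
      exact hclosed.mem_of_frequently_of_tendsto hfreq htend
    obtain ⟨ε, hε, hε0⟩ := (hfreq.and_eventually self_mem_nhdsWithin).exists
    obtain ⟨u, huc, hu⟩ : ∃ u ∈ c, cross (p x) (p y) (p u) < 0 := by
      by_contra! hall
      have hsub : convexHull ℝ (p '' (c : Set (Fin N))) ⊆ {P | 0 ≤ cross (p x) (p y) P} :=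
        convexHull_min (by rintro _ ⟨v, hv, rfl⟩; exact hall v hv) (convex_halfPlane _ _)
      have := hsub hε
      rw [Set.mem_ofPred_eq, cross_combo _ _ _ _ (by ring), hO0] at this
      have := hneg z hxz hzy
      have : (0 : ℝ) < ε := hε0
      nlinarith
    have hxu : x < u := by
      by_contra! h
      rcases h.eq_or_lt with rfl | h
      · rw [cross_left] at hu; exact lt_irrefl _ hu
      · have := hp u x y h (hxz.trans hzy)
        rw [cross_rotate] at hu; linarith
    have huy : u < y := by
      by_contra! h
      rcases h.eq_or_lt with rfl | h
      · rw [cross_right] at hu; exact lt_irrefl _ hu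
      · linarith [hp x y u (hxz.trans hzy) h]
    have hrange : ∀ v ∈ c, x ≤ v ∧ v ≤ y := by
      intro v hv
      rcases hxy with h | ⟨t, ht, hxt, hyt⟩
      · exact h v (mem_univ v)
      · constructor
        · by_contra! h
          exact hN c hc t ht v hv u huc x hxt y hyt h hxu huy
        · by_contra! h
          exact hN t ht c hc x hxt y hyt u huc v hv hxu huy h
    have hend : ∀ v, cross (p x) (p y) (p v) = 0 → O ≠ p v →
        ∃ v' ∈ c, v' ≠ v ∧ (v' = x ∨ v' = y) := by
      intro v hv hOv
      by_contra! hall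
      have hsub : convexHull ℝ (p '' (c : Set (Fin N))) ⊆
          {P | cross (p x) (p y) P < 0 ∨ P = p v} := by
        refine convexHull_min ?_ (convex_halfPlane_union_singleton hv)
        rintro _ ⟨v', hv', rfl⟩
        by_cases e : v' = v
        · exact Or.inr (by rw [e])
        · have h1 := hrange v' hv'
          have h2 := hall v' hv' e
          exact Or.inl (hneg v' (lt_of_le_of_ne h1.1 h2.1.symm) (lt_of_le_of_ne h1.2 h2.2))
      rcases hsub hOc with h | h
      · rw [hO0] at h; exact lt_irrefl _ h
      · exact hOv h
    have hxc : x ∈ c := by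
      obtain ⟨v, hv, hvy, rfl | rfl⟩ := hend y (cross_right _ _) fun h => hpxy (by
        have h' : (2⁻¹ : ℝ) • p x = (2⁻¹ : ℝ) • p y := by
          rw [eq_sub_of_add_eq h, ← sub_eq_zero]; module
        exact smul_right_injective _ (by norm_num) h')
      · exact hv
      · exact absurd rfl hvy
    have hyc : y ∈ c := by
      obtain ⟨v, hv, hvx, rfl | rfl⟩ := hend x (cross_left _ _) fun h => hpxy (by
        have h' : (2⁻¹ : ℝ) • p y = (2⁻¹ : ℝ) • p x := by
          rw [eq_sub_of_add_eq' h, ← sub_eq_zero]; module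
        exact smul_right_injective _ (by norm_num) h'.symm)
      · exact absurd rfl hvx
      · exact hv
    refine hcon u hxu huy ?_
    convert hc
    refine eq_of_subset_of_card_le ?_ ?_
    · simp [insert_subset_iff, *]
    · rw [hcard c hc, card_eq_three.2 ⟨x, u, y, hxu.ne, (hxu.trans huy).ne, huy.ne, rfl⟩]
  obtain ⟨ε, hε, hε0, hε1⟩ := (((Filter.eventually_all_finset T).2 hcell).and
    (Ioo_mem_nhdsGT (zero_lt_one (α := ℝ)))).exists
  have hmem : (1 - ε) • O + ε • p z ∈ convexHull ℝ (Set.range p) := by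
    have hv : ∀ v, p v ∈ convexHull ℝ (Set.range p) := fun v =>
      subset_convexHull ℝ _ (Set.mem_range_self v)
    exact convex_convexHull ℝ _ (convex_convexHull ℝ _ (hv x) (hv y) (by norm_num) (by norm_num)
      (by norm_num)) (hv z) (by linarith) hε0.le (by ring)
  rw [← hcover] at hmem
  simp only [Set.mem_iUnion] at hmem
  obtain ⟨c, hc, hmem⟩ := hmem
  exact hε c hc hmem

end ConvexPosition

theorem cross_vtx_pos (m : ℕ) (i j k : Fin (m + 1)) (hij : i < j) (hjk : j < k) :
    0 < cross (vtx (m + 1) i) (vtx (m + 1) j) (vtx (m + 1) k) := by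
  set θ : Fin (m + 1) → ℝ := fun s => Real.pi * (s : ℕ) / ((m + 1 : ℕ) : ℝ) with hθ
  have hv : ∀ s : Fin (m + 1), vtx (m + 1) s = (Real.cos (2 * θ s), Real.sin (2 * θ s)) := by
    intro s
    have : 2 * Real.pi * ((s : ℕ) : ℝ) / ((m + 1 : ℕ) : ℝ) = 2 * θ s := by
      simp only [hθ]; ring
    rw [← this]
    rfl
  have hmono : ∀ s t : Fin (m + 1), s < t → 0 < Real.sin (θ t - θ s) := by
    intro s t hst
    have hm : (0 : ℝ) < ((m + 1 : ℕ) : ℝ) := by positivity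
    have h1 : ((s : ℕ) : ℝ) < (t : ℕ) := by exact_mod_cast hst
    have h2 : ((t : ℕ) : ℝ) < ((m + 1 : ℕ) : ℝ) := by exact_mod_cast t.isLt
    have h3 : (0 : ℝ) ≤ (s : ℕ) := by positivity
    have e : θ t - θ s = Real.pi * (((t : ℕ) - (s : ℕ) : ℝ) / ((m + 1 : ℕ) : ℝ)) := by
      simp only [hθ]; ring
    rw [e]
    refine Real.sin_pos_of_pos_of_lt_pi (mul_pos Real.pi_pos (div_pos (by linarith) hm)) ?_
    have : ((t : ℕ) - (s : ℕ) : ℝ) / ((m + 1 : ℕ) : ℝ) < 1 := by rw [div_lt_one hm]; linarith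
    nlinarith [Real.pi_pos]
  have key : cross (vtx (m + 1) i) (vtx (m + 1) j) (vtx (m + 1) k) =
      4 * Real.sin (θ j - θ i) * Real.sin (θ k - θ j) * Real.sin (θ k - θ i) := by
    rw [hv i, hv j, hv k]
    simp only [cross, Real.cos_two_mul, Real.sin_two_mul, Real.sin_sub]
    have hi := Real.sin_sq_add_cos_sq (θ i)
    have hj := Real.sin_sq_add_cos_sq (θ j)
    have hk := Real.sin_sq_add_cos_sq (θ k)
    generalize Real.sin (θ i) = a at *
    generalize Real.cos (θ i) = a' at *
    generalize Real.sin (θ j) = b at *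
    generalize Real.cos (θ j) = b' at *
    generalize Real.sin (θ k) = c at *
    generalize Real.cos (θ k) = c' at *
    grind
  rw [key]
  have h1 := hmono i j hij
  have h2 := hmono j k hjk
  have h3 := hmono i k (hij.trans hjk)
  positivity

theorem isCombTriangulation_of_isDAngulation (m : ℕ) (T : Finset (Finset (Fin (m + 1))))
    (hT : IsDAngulation (m + 1) 3 T) : IsCombTriangulation univ T :=
  isCombTriangulation_of_cover (p := vtx (m + 1)) (cross_vtx_pos m) hT.1 hT.2.1 hT.2.2

theorem pathLen_eq (m : ℕ) (i j : Fin (m + 1)) :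
    pathLen (m + 1) i j = if i < j then (j : ℕ) - i - 1 else (j : ℕ) + (m + 1) - i - 1 := by
  have hval : pathLen (m + 1) i j = ((j - i - 1 : Fin (m + 1)) : ℕ) := rfl
  have hi := i.isLt
  have hj := j.isLt
  rw [hval]
  rcases Nat.eq_zero_or_pos m with rfl | hm
  · have := (j - i - 1).isLt
    split_ifs <;> omega
  · have h1 : ((1 : Fin (m + 1)) : ℕ) = 1 := by
      rw [Fin.val_one']; exact Nat.mod_eq_of_lt (by omega)
    rw [Fin.sub_def, Fin.sub_def]
    simp only [h1]
    split_ifs with h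
    · rw [Fin.lt_def] at h
      rw [show m + 1 - i.val + j.val = (j.val - i.val) + (m + 1) by omega, Nat.add_mod_right,
        Nat.mod_eq_of_lt (a := j.val - i.val) (by omega),
        show m + 1 - 1 + (j.val - i.val) = (j.val - i.val - 1) + (m + 1) by omega,
        Nat.add_mod_right, Nat.mod_eq_of_lt (by omega)]
    · rw [Fin.lt_def] at h
      rcases eq_or_ne j.val i.val with e | e
      · rw [show m + 1 - i.val + j.val = m + 1 by omega, Nat.mod_self,
          Nat.mod_eq_of_lt (by omega)]
        omega
      · rw [Nat.mod_eq_of_lt (a := m + 1 - i.val + j.val) (by omega),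
          show m + 1 - 1 + (m + 1 - i.val + j.val) = (m + 1 - i.val + j.val - 1) + (m + 1) by omega,
          Nat.add_mod_right, Nat.mod_eq_of_lt (by omega)]
        omega

theorem mem_cyclicIoo_univ_iff {m : ℕ} {i j s : Fin (m + 1)} :
    s ∈ cyclicIoo univ i j ↔ pathLen (m + 1) i s < pathLen (m + 1) i j := by
  rw [mem_cyclicIoo, pathLen_eq, pathLen_eq]
  simp only [mem_univ, true_and, Fin.lt_def]
  have := i.isLt
  have := j.isLt
  have := s.isLt
  split_ifs <;> omega

/-- The vertex at position `k` of a path starting at `i`. -/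
def stepVertex {m : ℕ} (i : Fin (m + 1)) (k : ℕ) : Fin (m + 1) :=
  (fun u : ZMod (m + 1) => u + 1 + (k : ZMod (m + 1))) i

theorem stepVertex_pathLen {m : ℕ} (i s : Fin (m + 1)) :
    stepVertex i (pathLen (m + 1) i s) = s := by
  have key : ∀ i s : ZMod (m + 1), i + 1 + ((pathLen (m + 1) i s : ℕ) : ZMod (m + 1)) = s := by
    intro i s
    rw [pathLen, ZMod.natCast_zmod_val]
    ring
  exact key i s

theorem pathLen_stepVertex {m : ℕ} (i : Fin (m + 1)) {k : ℕ} (hk : k < m + 1) :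
    pathLen (m + 1) i (stepVertex i k) = k := by
  have key : ∀ i : ZMod (m + 1), pathLen (m + 1) i (i + 1 + (k : ZMod (m + 1))) = k := by
    intro i
    rw [pathLen, show i + 1 + (k : ZMod (m + 1)) - i - 1 = k by ring, ZMod.val_natCast,
      Nat.mod_eq_of_lt hk]
  exact key i

theorem pathLen_lt {m : ℕ} (i j : Fin (m + 1)) : pathLen (m + 1) i j < m + 1 :=
  ZMod.val_lt (n := m + 1) _

theorem isDPath_three_iff {n : ℕ} {T : Finset (Finset (ZMod n))} {i j : ZMod n}
    {q : Fin (pathLen n i j) → {c // c ∈ T}} :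
    IsDPath n 3 T i j q ↔
      (∀ k, (i + 1 + ((k : ℕ) : ZMod n)) ∈ (q k : Finset (ZMod n))) ∧ Injective q := by
  refine and_congr_right fun _ => ⟨fun h k l hkl => ?_, fun h c _ => ?_⟩
  · exact card_le_one.1 (h (q k) (q k).2) k (by simp) l (by simp [hkl])
  · refine card_le_one.2 fun k hk l hl => h (Subtype.ext ?_)
    rw [(mem_filter.1 hk).2, (mem_filter.1 hl).2]

theorem dPathCount_three_eq_card {m : ℕ} (T : Finset (Finset (Fin (m + 1)))) (i j : Fin (m + 1)) :
    dPathCount (m + 1) 3 T i j =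
      Nat.card {q : Fin (pathLen (m + 1) i j) → {c // c ∈ T} //
        (∀ k, stepVertex i k ∈ (q k).1) ∧ Injective q} :=
  Nat.card_congr (Equiv.subtypeEquivRight fun _ => isDPath_three_iff)

theorem dPathCount_three_eq {m : ℕ} (T : Finset (Finset (Fin (m + 1)))) (i j : Fin (m + 1)) :
    dPathCount (m + 1) 3 T i j = pathNumber univ T i j := by
  have hlen : ∀ k : Fin (pathLen (m + 1) i j), pathLen (m + 1) i (stepVertex i k) = k := fun k =>
    pathLen_stepVertex i (k.isLt.trans (pathLen_lt i j))
  have hA : ∀ k : Fin (pathLen (m + 1) i j), stepVertex i k ∈ cyclicIoo univ i j := fun k => by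
    rw [mem_cyclicIoo_univ_iff, hlen]
    exact k.isLt
  rw [pathNumber, choiceCount, ← Nat.card_eq_finsetCard, dPathCount_three_eq_card]
  refine Nat.card_congr
    { toFun q := ⟨fun v => if h : v ∈ cyclicIoo univ i j then
        (q.1 ⟨pathLen (m + 1) i v, mem_cyclicIoo_univ_iff.1 h⟩).1 else ∅, ?_⟩
      invFun f := ⟨fun k => ⟨f.1 (stepVertex i k),
        ((mem_incidentChoices.1 f.2).1 _ (hA k)).1⟩, ?_⟩
      left_inv q := ?_
      right_inv f := ?_ }
  · obtain ⟨q, hq1, hq2⟩ := q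
    refine mem_incidentChoices.2 ⟨fun v hv => ?_, fun v hv => dif_neg hv, fun v hv w hw h => ?_⟩
    · have := hq1 ⟨pathLen (m + 1) i v, mem_cyclicIoo_univ_iff.1 hv⟩
      rw [stepVertex_pathLen] at this
      simp only [dif_pos hv]
      exact ⟨Subtype.prop _, this⟩
    · rw [mem_coe] at hv hw
      simp only [dif_pos hv, dif_pos hw] at h
      have h' : pathLen (m + 1) i v = pathLen (m + 1) i w :=
        Fin.mk.inj_iff.1 (hq2 (Subtype.ext h))
      rw [← stepVertex_pathLen i v, h', stepVertex_pathLen]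
  · obtain ⟨hf1, -, hf3⟩ := mem_incidentChoices.1 f.2
    refine ⟨fun k => (hf1 _ (hA k)).2, fun k l h => ?_⟩
    have h' := congrArg (pathLen (m + 1) i) (hf3 (hA k) (hA l) (congrArg Subtype.val h))
    rw [hlen, hlen] at h'
    exact Fin.ext h'
  · refine Subtype.ext (funext fun k => Subtype.ext ?_)
    simp only [dif_pos (hA k), hlen]
  · refine Subtype.ext (funext fun v => ?_)
    by_cases hv : v ∈ cyclicIoo univ i j
    · simp only [dif_pos hv]
      rw [stepVertex_pathLen]
    · simp only [dif_neg hv]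
      exact ((mem_incidentChoices.1 f.2).2.1 v hv).symm

end

/-- Broline–Crowe–Isaacs: for any triangulation `T` of the convex `n`-gon, the
determinant of the associated matrix of path numbers is `-(-2)^(n-2)`. -/
theorem det_triangulationMatrix (n : ℕ) (hn : 3 ≤ n)
    (T : Finset (Finset (ZMod n))) (hT : IsDAngulation n 3 T) :
    (Matrix.of fun i j : Fin n =>
        (dPathCount n 3 T ((i : ℕ) : ZMod n) ((j : ℕ) : ZMod n) : ℤ)).det
      = -(-2) ^ (n - 2) := by
  obtain ⟨m, rfl⟩ : ∃ m, n = m + 1 := ⟨n - 1, by omega⟩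
  have h := isCombTriangulation_of_isDAngulation m T hT
  have hdet := h.det_pathMatrix (by rw [Finset.card_univ, Fintype.card_fin]; omega)
  rw [Finset.card_univ, Fintype.card_fin] at hdet
  have hcast : ∀ s : Fin (m + 1), ((s : ℕ) : ZMod (m + 1)) = s := fun s =>
    ZMod.natCast_zmod_val (n := m + 1) s
  rw [← hdet]
  refine congrArg Matrix.det (Matrix.ext fun i j => ?_)
  refine Eq.trans ?_ (pathMatrix_univ_apply (N := m + 1) T i j).symm
  rw [Matrix.of_apply, hcast, hcast]
  exact congrArg Nat.cast (dPathCount_three_eq (m := m) T i j)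
end
end
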